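/- arXiv:2002.11527 — 4 statements merged into one kernel-verified Lean document; each statement's English description precedes it below -/
import Mathlib

section
/- Consider a first-order real ODE x·y'(x) = F(x,y(x)) for x ∈ [0,a], where y is ℝⁿ-valued (n ≥ 1) and F is real-analytic on an open neighborhood in ℝ^{1+n} of the graph {(x,y(x)) : x ∈ [0,a]}. If the ODE has a solution y which is C∞ on [0,a], then y is real-analytic everywhere on [0,a]; in particular, near the singular point x = 0, y coincides with a convergent power series. -/
open Set

open scoped ContDiff Nat NNReal ENNReal Topology

section Composition

variable {V W : Type*} [NormedAddCommGroup V] [NormedSpace ℝ V] [NormedAddCommGroup W]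
  [NormedSpace ℝ W]

/-- A one-variable polynomial with coefficients in `V` is its own power series expansion. -/
theorem hasFPowerSeriesAt_sum_pow_smul (z : ℕ → V) (N : ℕ) (x : ℝ) :
    HasFPowerSeriesAt (fun t : ℝ => ∑ i ∈ Finset.range N, (t - x) ^ i • z i)
      (fun i => ContinuousMultilinearMap.mkPiRing ℝ (Fin i) (if i < N then z i else 0)) x := by
  refine hasFPowerSeriesAt_iff'.2 (Filter.Eventually.of_forall fun t => ?_)
  have h : HasSum (fun i => (t - x) ^ i • (if i < N then z i else 0))
      (∑ i ∈ Finset.range N, (t - x) ^ i • (if i < N then z i else 0)) :=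
    hasSum_sum_of_ne_finset_zero fun i hi => by simp [Finset.mem_range.not.mp hi]
  convert h using 1
  · funext i
    simp [FormalMultilinearSeries.coeff]
  · exact Finset.sum_congr rfl fun i hi => by simp [Finset.mem_range.mp hi]

theorem HasFPowerSeriesAt.factorial_smul_coeff [CompleteSpace V] {f : ℝ → V}
    {p : FormalMultilinearSeries ℝ ℝ V} {x : ℝ} (h : HasFPowerSeriesAt f p x) (i : ℕ) :
    iteratedDeriv i f x = (i ! : ℝ) • p i fun _ => 1 := by
  obtain ⟨r, hr⟩ := h
  rw [iteratedDeriv_eq_iteratedFDeriv, ← hr.factorial_smul 1 i, Nat.cast_smul_eq_nsmul]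

theorem FormalMultilinearSeries.taylorComp_congr {q : FormalMultilinearSeries ℝ V W}
    {p p' : FormalMultilinearSeries ℝ ℝ V} {n : ℕ} (h : ∀ i ≤ n, p i = p' i) :
    q.taylorComp p n = q.taylorComp p' n := by
  unfold FormalMultilinearSeries.taylorComp
  refine Finset.sum_congr rfl fun c _ => ?_
  unfold FormalMultilinearSeries.compAlongOrderedFinpartition
  congr 1
  funext m
  exact h _ (c.partSize_le m)

/-- The norm of an iterated derivative of a composition, in terms of the power series of the
outer function and the Taylor coefficients of the inner one. -/
theorem norm_iteratedDerivWithin_comp_le [CompleteSpace V] [CompleteSpace W] {s : Set ℝ}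
    (hs : UniqueDiffOn ℝ s) {x : ℝ} (hx : x ∈ s) {γ : ℝ → V} (hγ : ContDiffWithinAt ℝ ∞ γ s x)
    {Φ : V → W} {q : FormalMultilinearSeries ℝ V W} (hq : HasFPowerSeriesAt Φ q (γ x)) (j : ℕ) :
    ‖iteratedDerivWithin j (Φ ∘ γ) s x‖ ≤
      j ! * ∑ c : Composition j, ‖q c.length‖ *
        ∏ i, (‖iteratedDerivWithin (c.blocksFun i) γ s x‖ / (c.blocksFun i)!) := by
  set z : ℕ → V := fun i => (i ! : ℝ)⁻¹ • iteratedDerivWithin i γ s x with hz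
  set P : ℝ → V := fun t => ∑ i ∈ Finset.range (j + 1), (t - x) ^ i • z i with hP
  have hPp := hasFPowerSeriesAt_sum_pow_smul z (j + 1) x
  set p : FormalMultilinearSeries ℝ ℝ V := fun i =>
    ContinuousMultilinearMap.mkPiRing ℝ (Fin i) (if i < j + 1 then z i else 0) with hp
  have hPx : P x = γ x := by
    rw [hP]
    simp only [sub_self]
    rw [Finset.sum_eq_single 0] <;> simp +contextual [hz]
  have hPc : ContDiffAt ℝ ∞ P x := hPp.analyticAt.contDiffAt
  have hΦ : ContDiffAt ℝ ∞ Φ (γ x) := hq.analyticAt.contDiffAt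
  have hcomp : HasFPowerSeriesAt (Φ ∘ P) (q.comp p) x :=
    HasFPowerSeriesAt.comp (by rwa [hPx]) hPp
  have key : iteratedFDerivWithin ℝ j (Φ ∘ γ) s x = iteratedFDeriv ℝ j (Φ ∘ P) x := by
    rw [iteratedFDeriv_comp (n := ∞) (by rwa [hPx]) hPc (mod_cast le_top),
      iteratedFDerivWithin_comp_of_eventually_mem (t := univ) (n := ∞) hΦ hγ uniqueDiffOn_univ hs hx
        (Filter.Eventually.of_forall fun _ => mem_univ _) (mod_cast le_top),
      ftaylorSeriesWithin_univ, hPx]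
    refine FormalMultilinearSeries.taylorComp_congr fun i hi => ?_
    refine ContinuousMultilinearMap.ext_ring ?_
    change iteratedDerivWithin i γ s x = iteratedDeriv i P x
    rw [hPp.factorial_smul_coeff]
    simp [hp, hz, hi, smul_smul, Nat.factorial_ne_zero, -Order.lt_add_one_iff, Nat.lt_succ_iff]
  have hval : iteratedDerivWithin j (Φ ∘ γ) s x =
      (j ! : ℝ) • (q.comp p) j fun _ => 1 := by
    rw [← hcomp.factorial_smul_coeff, iteratedDeriv_eq_iteratedFDeriv,
      iteratedDerivWithin_eq_iteratedFDerivWithin, key]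
  rw [hval, norm_smul, Real.norm_natCast]
  refine mul_le_mul_of_nonneg_left ?_ (Nat.cast_nonneg _)
  have : (q.comp p) j (fun _ => 1) =
      ∑ c : Composition j, q.compAlongComposition p c (fun _ => 1) := by
    simp [FormalMultilinearSeries.comp]
  rw [this]
  refine (norm_sum_le _ _).trans (Finset.sum_le_sum fun c _ => ?_)
  refine ((q.compAlongComposition p c).le_opNorm _).trans ?_
  simp only [norm_one, Finset.prod_const_one, mul_one]
  refine (q.compAlongComposition_norm p c).trans ?_
  gcongr with i
  simp only [hp, ContinuousMultilinearMap.norm_mkPiRing]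
  split_ifs
  · simp [hz, norm_smul, div_eq_inv_mul]
  · simpa using by positivity

end Composition

section GeometricBound

variable {V W : Type*} [NormedAddCommGroup V] [NormedSpace ℝ V] [NormedAddCommGroup W]
  [NormedSpace ℝ W]

theorem FormalMultilinearSeries.exists_nnnorm_changeOrigin_mul_pow_le
    (p : FormalMultilinearSeries ℝ V W) {r : ℝ≥0} (hr : (r + r : ℝ≥0∞) < p.radius) :
    ∃ T : ℝ≥0, ∀ w : V, ‖w‖₊ ≤ r → ∀ k, ‖p.changeOrigin w k‖₊ * r ^ k ≤ T := by
  have hS := p.changeOriginSeries_summable_aux₁ hr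
  refine ⟨∑' s : Σ k l : ℕ, { s : Finset (Fin (k + l)) // s.card = l },
      ‖p (s.1 + s.2.1)‖₊ * r ^ s.2.1 * r ^ s.1, fun w hw k => ?_⟩
  have hrlt : (r : ℝ≥0∞) < p.radius := lt_of_le_of_lt le_self_add hr
  have hw' : (‖w‖₊ : ℝ≥0∞) < p.radius := lt_of_le_of_lt (by exact_mod_cast hw) hrlt
  calc ‖p.changeOrigin w k‖₊ * r ^ k
      ≤ (∑' s : Σ l : ℕ, { s : Finset (Fin (k + l)) // s.card = l },
          ‖p (k + s.1)‖₊ * r ^ s.1) * r ^ k := by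
        gcongr
        refine (p.nnnorm_changeOrigin_le k hw').trans ?_
        exact Summable.tsum_le_tsum (fun s => by gcongr)
          (p.changeOriginSeries_summable_aux₂ hw' k)
          (p.changeOriginSeries_summable_aux₂ hrlt k)
    _ = ∑' s : Σ l : ℕ, { s : Finset (Fin (k + l)) // s.card = l },
          ‖p (k + s.1)‖₊ * r ^ s.1 * r ^ k := (NNReal.tsum_mul_right _ _).symm
    _ ≤ _ := NNReal.tsum_comp_le_tsum_of_inj
          (f := fun s : Σ k l : ℕ, { s : Finset (Fin (k + l)) // s.card = l } =>
            ‖p (s.1 + s.2.1)‖₊ * r ^ s.2.1 * r ^ s.1) hS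
          (i := fun s => ⟨k, s⟩)
          (fun a b hab => eq_of_heq (Sigma.mk.inj hab).2)

/-- On a compact set of analyticity, the power series at all points admit a common geometric
bound. -/
theorem IsCompact.exists_hasFPowerSeriesAt_norm_le [CompleteSpace W] {K : Set V}
    (hK : IsCompact K) {Φ : V → W} (hΦ : AnalyticOnNhd ℝ Φ K) :
    ∃ M C : ℝ, 0 < M ∧ 0 < C ∧ ∀ v ∈ K, ∃ q : FormalMultilinearSeries ℝ V W,
      HasFPowerSeriesAt Φ q v ∧ ∀ n, ‖q n‖ ≤ M * C ^ n := by
  refine hK.induction_on (p := fun K => ∃ M C : ℝ, 0 < M ∧ 0 < C ∧ ∀ v ∈ K,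
    ∃ q : FormalMultilinearSeries ℝ V W, HasFPowerSeriesAt Φ q v ∧ ∀ n, ‖q n‖ ≤ M * C ^ n)
    ⟨1, 1, one_pos, one_pos, by simp⟩ ?_ ?_ ?_
  · rintro s t hst ⟨M, C, hM, hC, h⟩
    exact ⟨M, C, hM, hC, fun v hv => h v (hst hv)⟩
  · rintro s t ⟨M, C, hM, hC, h⟩ ⟨M', C', hM', hC', h'⟩
    refine ⟨max M M', max C C', lt_max_of_lt_left hM, lt_max_of_lt_left hC, ?_⟩
    rintro v (hv | hv)
    · obtain ⟨q, hq, hb⟩ := h v hv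
      refine ⟨q, hq, fun n => (hb n).trans ?_⟩
      gcongr <;> exact le_max_left _ _
    · obtain ⟨q, hq, hb⟩ := h' v hv
      refine ⟨q, hq, fun n => (hb n).trans ?_⟩
      gcongr <;> exact le_max_right _ _
  · intro v hv
    obtain ⟨p, R, hp⟩ := hΦ v hv
    obtain ⟨ρ, hρ0, hρ⟩ := ENNReal.lt_iff_exists_nnreal_btwn.1 hp.r_pos
    have hρ0' : 0 < ρ := by exact_mod_cast hρ0
    set r : ℝ≥0 := ρ / 2 with hr
    have hr0 : 0 < r := by positivity
    have hrr : (r + r : ℝ≥0∞) < p.radius := by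
      refine lt_of_eq_of_lt ?_ (hρ.trans_le hp.r_le)
      rw [← ENNReal.coe_add, hr, add_halves]
    obtain ⟨T, hbound⟩ := p.exists_nnnorm_changeOrigin_mul_pow_le hrr
    have hsmall : Metric.ball v r ∈ 𝓝[K] v :=
      mem_nhdsWithin_of_mem_nhds (Metric.ball_mem_nhds v (by exact_mod_cast hr0))
    refine ⟨Metric.ball v r, hsmall, T + 1, (r : ℝ)⁻¹, by positivity, by positivity, ?_⟩
    intro u hu
    have hu' : ‖u - v‖₊ ≤ r := by
      rw [← NNReal.coe_le_coe, coe_nnnorm, ← dist_eq_norm]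
      exact (Metric.mem_ball.1 hu).le
    have huR : (‖u - v‖₊ : ℝ≥0∞) < R := by
      refine lt_of_le_of_lt ?_ hρ
      exact_mod_cast hu'.trans (by rw [hr]; exact half_le_self zero_le)
    refine ⟨p.changeOrigin (u - v), ?_, fun n => ?_⟩
    · simpa using (hp.changeOrigin huR).hasFPowerSeriesAt
    · have h := hbound (u - v) hu' n
      rw [← NNReal.coe_le_coe] at h
      push_cast at h
      rw [inv_pow, ← div_eq_mul_inv, le_div_iff₀ (by positivity)]
      linarith

end GeometricBound

section Majorant

theorem sum_composition_le {Q u : ℕ → ℝ} (hQ : ∀ n, 0 ≤ Q n) (hu : ∀ n, 0 ≤ u n) (k : ℕ) :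
    ∑ j ∈ Finset.range k, ∑ c : Composition j, Q c.length * ∏ i, u (c.blocksFun i) ≤
      ∑ n ∈ Finset.range k, Q n * (∑ b ∈ Finset.Ico 1 k, u b) ^ n := by
  have hsub : (Finset.range k).sigma (fun j => (Finset.univ : Finset (Composition j))) ⊆
      FormalMultilinearSeries.compPartialSumTarget 0 k k := by
    rintro ⟨j, c⟩ h
    have hj : j < k := by simpa using h
    rw [FormalMultilinearSeries.mem_compPartialSumTarget_iff]
    exact ⟨Nat.zero_le _, c.length_le.trans_lt hj, fun i => (c.blocksFun_le i).trans_lt hj⟩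
  calc _ = ∑ e ∈ (Finset.range k).sigma (fun j => (Finset.univ : Finset (Composition j))),
        Q e.2.length * ∏ i, u (e.2.blocksFun i) := by rw [Finset.sum_sigma]
    _ ≤ ∑ e ∈ FormalMultilinearSeries.compPartialSumTarget 0 k k,
        Q e.2.length * ∏ i, u (e.2.blocksFun i) :=
      Finset.sum_le_sum_of_subset_of_nonneg hsub fun e _ _ =>
        mul_nonneg (hQ _) (Finset.prod_nonneg fun i _ => hu _)
    _ = ∑ e ∈ FormalMultilinearSeries.compPartialSumSource 0 k k, Q e.1 * ∏ i, u (e.2 i) := by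
      symm
      apply FormalMultilinearSeries.compChangeOfVariables_sum 0 k k
      rintro ⟨n, b⟩ H
      have hl := FormalMultilinearSeries.compChangeOfVariables_length 0 k k H
      have hb := FormalMultilinearSeries.compChangeOfVariables_blocksFun 0 k k H
      refine congrArg₂ (· * ·) (congrArg Q hl.symm) ?_
      refine Fintype.prod_equiv (finCongr hl.symm) _ _ fun i => ?_
      rw [← hb i]
      rfl
    _ = _ := by
      unfold FormalMultilinearSeries.compPartialSumSource
      rw [Finset.sum_sigma, ← Finset.range_eq_Ico]
      refine Finset.sum_congr rfl fun n _ => ?_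
      change ∑ s ∈ Fintype.piFinset fun _ : Fin n => Finset.Ico 1 k, Q n * ∏ i, u (s i) = _
      rw [← Finset.mul_sum, Finset.sum_prod_piFinset]
      simp

/-- Geometric growth of a nonnegative sequence satisfying the majorant recursion of a
Briot–Bouquet equation. -/
theorem exists_mul_pow_le_of_composition_bound {Y : ℕ → ℝ} (hY : ∀ j, 0 ≤ Y j) {M C : ℝ}
    (hM : 0 < M) (hC : 0 < C)
    (h : ∀ j : ℕ, j * Y j ≤
      ∑ c : Composition j, M * C ^ c.length * ∏ i, Y (c.blocksFun i)) :
    ∃ r D : ℝ, 0 < r ∧ 0 < D ∧ ∀ j, Y j * r ^ j ≤ D := by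
  obtain ⟨N, hN⟩ := exists_nat_gt (16 * M * C)
  have hN0 : (0 : ℝ) < N := lt_trans (by positivity) hN
  have hN1 : 1 ≤ N := by exact_mod_cast hN0
  set low : ℝ → ℝ := fun s => ∑ b ∈ Finset.Ico 1 N, Y b * s ^ b with hlow
  obtain ⟨r, hr0, hr⟩ : ∃ r > 0, ∀ s ∈ Icc 0 r, low s ≤ 1 / (4 * C) := by
    have hc : Continuous low := by fun_prop
    have h0 : low 0 = 0 := Finset.sum_eq_zero fun b hb => by
      have : b ≠ 0 := by have := (Finset.mem_Ico.1 hb).1; omega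
      simp [this]
    have hlt : ∀ᶠ s in 𝓝 (0 : ℝ), low s < 1 / (4 * C) :=
      hc.continuousAt.eventually_lt continuousAt_const (by rw [h0]; positivity)
    obtain ⟨ε, hε, hs⟩ := Metric.eventually_nhds_iff.1 hlt
    refine ⟨ε / 2, by positivity, fun s hs' => (hs ?_).le⟩
    rw [Real.dist_0_eq_abs, abs_of_nonneg hs'.1]
    linarith [hs'.2]
  have gap : ∀ k, ∀ s ∈ Icc 0 r, ∑ b ∈ Finset.Ico N k, Y b * s ^ b ≤ 1 / (4 * C) →
      ∑ b ∈ Finset.Ico N k, Y b * s ^ b ≤ 1 / (8 * C) := by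
    intro k s hs hT
    rcases le_or_gt k N with hk | hk
    · rw [Finset.Ico_eq_empty_of_le hk, Finset.sum_empty]
      positivity
    have hu : ∀ b, 0 ≤ Y b * s ^ b := fun b => mul_nonneg (hY b) (pow_nonneg hs.1 b)
    have hsum : ∑ b ∈ Finset.Ico 1 k, Y b * s ^ b ≤ 1 / (2 * C) := by
      rw [← Finset.sum_Ico_consecutive _ hN1 hk.le]
      have := hr s hs
      have e : 1 / (2 * C) = 1 / (4 * C) + 1 / (4 * C) := by field_simp; norm_num
      rw [e]
      exact add_le_add this hT
    have hNT : N * ∑ b ∈ Finset.Ico N k, Y b * s ^ b ≤ 2 * M := by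
      calc N * ∑ b ∈ Finset.Ico N k, Y b * s ^ b
          ≤ ∑ b ∈ Finset.Ico N k, b * (Y b * s ^ b) := by
            rw [Finset.mul_sum]
            refine Finset.sum_le_sum fun b hb => ?_
            have := (Finset.mem_Ico.1 hb).1
            have := hu b
            gcongr
        _ ≤ ∑ b ∈ Finset.range k, b * (Y b * s ^ b) := by
            refine Finset.sum_le_sum_of_subset_of_nonneg (fun b hb => ?_) fun b _ _ =>
              mul_nonneg (Nat.cast_nonneg _) (hu b)
            exact Finset.mem_range.2 (Finset.mem_Ico.1 hb).2
        _ ≤ ∑ j ∈ Finset.range k, ∑ c : Composition j,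
              (M * C ^ c.length) * ∏ i, (Y (c.blocksFun i) * s ^ c.blocksFun i) := by
            refine Finset.sum_le_sum fun j _ => ?_
            rw [← mul_assoc]
            refine (mul_le_mul_of_nonneg_right (h j) (pow_nonneg hs.1 j)).trans_eq ?_
            rw [Finset.sum_mul]
            refine Finset.sum_congr rfl fun c _ => ?_
            rw [Finset.prod_mul_distrib, Finset.prod_pow_eq_pow_sum, c.sum_blocksFun, mul_assoc]
        _ ≤ ∑ n ∈ Finset.range k, (M * C ^ n) * (∑ b ∈ Finset.Ico 1 k, Y b * s ^ b) ^ n :=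
            sum_composition_le (Q := fun n => M * C ^ n) (u := fun b => Y b * s ^ b)
              (fun n => by positivity) hu k
        _ ≤ ∑ n ∈ Finset.range k, M * (1 / 2) ^ n := by
            refine Finset.sum_le_sum fun n _ => ?_
            rw [mul_assoc, ← mul_pow]
            have h0 : 0 ≤ ∑ b ∈ Finset.Ico 1 k, Y b * s ^ b := Finset.sum_nonneg fun b _ => hu b
            gcongr
            calc C * _ ≤ C * (1 / (2 * C)) := by gcongr
              _ = 1 / 2 := by field_simp
        _ ≤ 2 * M := by
            rw [← Finset.mul_sum, mul_comm]
            have := sum_geometric_two_le k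
            gcongr
    have hT0 : 0 ≤ ∑ b ∈ Finset.Ico N k, Y b * s ^ b := Finset.sum_nonneg fun b _ => hu b
    rw [le_div_iff₀ (by positivity)]
    by_contra! hcon
    nlinarith [mul_lt_mul_of_pos_left hcon (show 0 < 2 * M by positivity)]
  have htail : ∀ k, ∑ b ∈ Finset.Ico N k, Y b * r ^ b ≤ 1 / (8 * C) := by
    intro k
    by_contra! hcon
    set T : ℝ → ℝ := fun s => ∑ b ∈ Finset.Ico N k, Y b * s ^ b with hT
    have hT0 : T 0 = 0 := Finset.sum_eq_zero fun b hb => by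
      have : b ≠ 0 := by have := (Finset.mem_Ico.1 hb).1; omega
      simp [this]
    have hTc : ContinuousOn T (Icc 0 r) := by fun_prop
    have h84 : 1 / (8 * C) < 1 / (4 * C) := by gcongr; norm_num
    have hmem : min (T r) (1 / (4 * C)) ∈ Icc (T 0) (T r) := by
      refine ⟨?_, min_le_left _ _⟩
      rw [hT0]
      exact le_min (le_trans (by positivity) hcon.le) (by positivity)
    obtain ⟨s, hs, hTs⟩ := intermediate_value_Icc hr0.le hTc hmem
    have h1 := gap k s hs (hTs.le.trans (min_le_right _ _))
    have h2 : 1 / (8 * C) < T s := by rw [hTs]; exact lt_min hcon h84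
    exact absurd h1 (not_le.2 h2)
  have hu : ∀ b, 0 ≤ Y b * r ^ b := fun b => mul_nonneg (hY b) (pow_nonneg hr0.le b)
  have hC4 : 0 < 1 / (4 * C) := by positivity
  refine ⟨r, Y 0 + 1 / (4 * C), hr0, add_pos_of_nonneg_of_pos (hY 0) hC4, fun j => ?_⟩
  rcases Nat.eq_zero_or_pos j with rfl | hj
  · simpa using by positivity
  refine le_trans ?_ (le_add_of_nonneg_left (hY 0))
  rcases lt_or_ge j N with hjN | hjN
  · exact (Finset.single_le_sum (f := fun b => Y b * r ^ b) (fun b _ => hu b)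
      (Finset.mem_Ico.2 ⟨hj, hjN⟩)).trans (hr r ⟨hr0.le, le_rfl⟩)
  · refine (Finset.single_le_sum (f := fun b => Y b * r ^ b) (fun b _ => hu b)
      (Finset.mem_Ico.2 ⟨hjN, j.lt_succ_self⟩)).trans ((htail (j + 1)).trans ?_)
    gcongr
    norm_num

end Majorant

section BriotBouquet

variable {V : Type*} [NormedAddCommGroup V] [NormedSpace ℝ V]

theorem mul_norm_le_of_smul_deriv_add_smul {a : ℝ} {f f' h : ℝ → V} {j : ℕ} {B : ℝ}
    (hf : ∀ x ∈ Icc 0 a, HasDerivWithinAt f (f' x) (Icc 0 a) x)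
    (hode : ∀ x ∈ Icc 0 a, x • f' x + (j : ℝ) • f x = h x) (hB : ∀ x ∈ Icc 0 a, ‖h x‖ ≤ B)
    {x : ℝ} (hx : x ∈ Icc 0 a) : j * ‖f x‖ ≤ B := by
  have hB0 : 0 ≤ B := (norm_nonneg _).trans (hB x hx)
  rcases Nat.eq_zero_or_pos j with rfl | hj
  · simpa using hB0
  obtain ⟨m, rfl⟩ : ∃ m, j = m + 1 := ⟨j - 1, by omega⟩
  have hm : (0 : ℝ) < (m + 1 : ℕ) := by exact_mod_cast hj
  rcases hx.1.eq_or_lt with h0 | h0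
  · subst h0
    have := hode 0 hx
    rw [zero_smul, zero_add] at this
    simpa only [← this, norm_smul, Real.norm_natCast] using hB 0 hx
  have hpow : ∀ t : ℝ, HasDerivAt (fun t : ℝ => t ^ (m + 1)) ((m + 1 : ℕ) * t ^ m) t := fun t => by
    simpa using hasDerivAt_pow (m + 1) t
  have hg : ∀ t ∈ Icc 0 a, HasDerivWithinAt (fun t => t ^ (m + 1) • f t) (t ^ m • h t)
      (Icc 0 a) t := by
    intro t ht
    refine ((hpow t).hasDerivWithinAt.smul (hf t ht)).congr_deriv ?_
    rw [← hode t ht, smul_add, smul_smul, smul_smul, pow_succ, mul_comm (t ^ m) ((m + 1 : ℕ) : ℝ)]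
  have hkey := image_norm_le_of_norm_deriv_right_le_deriv_boundary' (a := 0) (b := a)
    (f := fun t => t ^ (m + 1) • f t) (f' := fun t => t ^ m • h t)
    (B := fun t => B / (m + 1 : ℕ) * t ^ (m + 1)) (B' := fun t => B * t ^ m)
    (fun t ht => (hg t ht).continuousWithinAt)
    (fun t ht => (hg t ⟨ht.1, ht.2.le⟩).mono_of_mem_nhdsWithin (Icc_mem_nhdsGE_of_mem ht))
    (by simp) (by fun_prop)
    (fun t _ => by
      refine HasDerivAt.hasDerivWithinAt ?_
      refine ((hpow t).const_mul (B / (m + 1 : ℕ))).congr_deriv ?_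
      rw [← mul_assoc, div_mul_cancel₀ _ hm.ne'])
    (fun t ht => by
      rw [norm_smul, norm_pow, Real.norm_of_nonneg ht.1, mul_comm]
      exact mul_le_mul_of_nonneg_right (hB t ⟨ht.1, ht.2.le⟩) (pow_nonneg ht.1 m)) hx
  simp only [norm_smul, norm_pow, Real.norm_of_nonneg hx.1] at hkey
  have hxp : 0 < x ^ (m + 1) := pow_pos h0 _
  rw [mul_comm (B / _)] at hkey
  have := le_of_mul_le_mul_left hkey hxp
  rwa [le_div_iff₀ hm, mul_comm] at this

theorem iteratedDerivWithin_smul_derivWithin {s : Set ℝ} (hs : UniqueDiffOn ℝ s) {γ : ℝ → V}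
    (hγ : ContDiffOn ℝ ∞ γ s) (j : ℕ) :
    EqOn (iteratedDerivWithin j (fun x => x • derivWithin γ s x) s)
      (fun x => x • iteratedDerivWithin (j + 1) γ s x + (j : ℝ) • iteratedDerivWithin j γ s x)
      s := by
  have hd : ∀ i, ∀ x ∈ s, HasDerivWithinAt (iteratedDerivWithin i γ s)
      (iteratedDerivWithin (i + 1) γ s x) s x := fun i x hx => by
    rw [iteratedDerivWithin_succ]
    exact (hγ.differentiableOn_iteratedDerivWithin (mod_cast ENat.natCast_lt_top i) hs x
      hx).hasDerivWithinAt
  induction j with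
  | zero =>
    intro x hx
    simp
  | succ j ih =>
    intro x hx
    rw [iteratedDerivWithin_succ, derivWithin_congr ih (ih hx)]
    refine HasDerivWithinAt.derivWithin ?_ (hs x hx)
    refine (((hasDerivWithinAt_id x s).smul (hd (j + 1) x hx)).add
      ((hd j x hx).const_smul (j : ℝ))).congr_deriv ?_
    simp only [id, one_smul, Nat.cast_add, Nat.cast_one, add_smul]
    abel

/-- A smooth function on an interval whose derivatives grow at most like `j ! * R ^ j` extends
analytically near every point of the interval. -/
theorem exists_analyticAt_eventuallyEq_of_iteratedDerivWithin_le [CompleteSpace V] {a b : ℝ}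
    (hab : a < b) {γ : ℝ → V} (hγ : ContDiffOn ℝ ∞ γ (Icc a b)) {D R : ℝ} (hD : 0 < D)
    (hR : 0 < R)
    (hb : ∀ j, ∀ x ∈ Icc a b, ‖iteratedDerivWithin j γ (Icc a b) x‖ ≤ D * j ! * R ^ j)
    {x₀ : ℝ} (hx₀ : x₀ ∈ Icc a b) :
    ∃ g : ℝ → V, AnalyticAt ℝ g x₀ ∧ ∀ᶠ x in 𝓝[Icc a b] x₀, γ x = g x := by
  have hs : UniqueDiffOn ℝ (Icc a b) := uniqueDiffOn_Icc hab
  set p : FormalMultilinearSeries ℝ ℝ V := fun i =>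
    ContinuousMultilinearMap.mkPiRing ℝ (Fin i)
      ((i ! : ℝ)⁻¹ • iteratedDerivWithin i γ (Icc a b) x₀) with hp
  have hpn : ∀ n, ‖p n‖ ≤ D * R ^ n := fun n => by
    rw [hp]
    simp only [ContinuousMultilinearMap.norm_mkPiRing, norm_smul, norm_inv, Real.norm_natCast]
    rw [inv_mul_le_iff₀ (by positivity)]
    refine (hb n x₀ hx₀).trans_eq ?_
    ring
  obtain ⟨ρ, hρ⟩ : ∃ ρ : ℝ≥0, (ρ : ℝ) = R⁻¹ := ⟨⟨R⁻¹, by positivity⟩, rfl⟩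
  have hρ0 : 0 < ρ := by rw [← NNReal.coe_pos, hρ]; positivity
  have hrad : (ρ : ℝ≥0∞) ≤ p.radius := by
    refine p.le_radius_of_bound D fun n => ?_
    rw [hρ]
    calc ‖p n‖ * (R⁻¹) ^ n ≤ D * R ^ n * (R⁻¹) ^ n := by gcongr; exact hpn n
      _ = D := by rw [mul_assoc, ← mul_pow, mul_inv_cancel₀ hR.ne', one_pow, mul_one]
  have hpos : 0 < p.radius := lt_of_lt_of_le (by exact_mod_cast hρ0) hrad
  have hsum := p.hasFPowerSeriesOnBall hpos
  refine ⟨fun x => p.sum (x - x₀), ?_, ?_⟩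
  · have := hsum.comp_sub x₀
    rw [zero_add] at this
    exact this.analyticAt
  have hnear : ∀ᶠ x in 𝓝[Icc a b] x₀, x ∈ Icc a b ∧ |x - x₀| < 1 / (4 * R) := by
    refine eventually_mem_nhdsWithin.and (mem_nhdsWithin_of_mem_nhds ?_)
    exact Metric.ball_mem_nhds x₀ (by positivity)
  filter_upwards [hnear] with x ⟨hx, hxR⟩
  have hRx : R * |x - x₀| ≤ 1 / 4 := by
    rw [lt_div_iff₀ (by positivity)] at hxR
    linarith
  have hseg : uIcc x₀ x ⊆ Icc a b := ordConnected_Icc.uIcc_subset hx₀ hx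
  have hd : ∀ n : ℕ, ∀ t ∈ uIcc x₀ x, HasDerivWithinAt (fun t => taylorWithinEval γ n (Icc a b) t x)
      (((n ! : ℝ)⁻¹ * (x - t) ^ n) • iteratedDerivWithin (n + 1) γ (Icc a b) t) (uIcc x₀ x) t :=
    fun n t ht => (hasDerivWithinAt_taylorWithinEval_at_Icc x hab (hseg ht)
      (hγ.of_le (mod_cast le_top))
      (hγ.differentiableOn_iteratedDerivWithin (mod_cast ENat.natCast_lt_top n) hs)).mono hseg
  have hrem : ∀ n : ℕ, ‖γ x - taylorWithinEval γ n (Icc a b) x₀ x‖ ≤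
      D * R * |x - x₀| * (1 / 2) ^ n := by
    intro n
    have hmv := Convex.norm_image_sub_le_of_norm_hasDerivWithin_le (C := D * R * (1 / 2) ^ n)
      (hd n) ?_ (convex_uIcc x₀ x) left_mem_uIcc right_mem_uIcc
    · rw [taylorWithinEval_self, Real.norm_eq_abs] at hmv
      exact hmv.trans_eq (by ring)
    · intro t ht
      have htx : |x - t| ≤ |x - x₀| := abs_sub_right_of_mem_uIcc ht
      have h2 : ((n + 1 : ℕ) : ℝ) ≤ 2 ^ n := by exact_mod_cast Nat.lt_two_pow_self
      rw [norm_smul, norm_mul, norm_inv, Real.norm_natCast, norm_pow, Real.norm_eq_abs]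
      calc (n ! : ℝ)⁻¹ * |x - t| ^ n * ‖iteratedDerivWithin (n + 1) γ (Icc a b) t‖
          ≤ (n ! : ℝ)⁻¹ * |x - x₀| ^ n * (D * (n + 1)! * R ^ (n + 1)) := by
            gcongr
            exact hb (n + 1) t (hseg ht)
        _ = D * R * (((n + 1 : ℕ) : ℝ) * (R * |x - x₀|) ^ n) := by
            rw [Nat.factorial_succ]
            push_cast
            field_simp
            ring
        _ ≤ D * R * (2 ^ n * (1 / 4) ^ n) := by gcongr
        _ = D * R * (1 / 2) ^ n := by rw [← mul_pow]; norm_num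
  have hlim1 : Filter.Tendsto (fun n => taylorWithinEval γ n (Icc a b) x₀ x) Filter.atTop
      (𝓝 (γ x)) := by
    rw [tendsto_iff_norm_sub_tendsto_zero]
    refine squeeze_zero (fun n => norm_nonneg _)
      (fun n => (norm_sub_rev _ _).trans_le (hrem n)) ?_
    simpa using (tendsto_pow_atTop_nhds_zero_of_lt_one (r := (1 / 2 : ℝ)) (by norm_num)
      (by norm_num)).const_mul (D * R * |x - x₀|)
  have hmem : x - x₀ ∈ Metric.eball (0 : ℝ) p.radius := by
    rw [mem_eball_zero_iff]
    refine lt_of_lt_of_le ?_ hrad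
    rw [← ofReal_norm, ENNReal.ofReal_lt_coe_iff (norm_nonneg _), Real.norm_eq_abs]
    refine hxR.trans_le ?_
    rw [hρ, one_div]
    gcongr
    linarith
  have hlim2 : Filter.Tendsto (fun n => taylorWithinEval γ n (Icc a b) x₀ x) Filter.atTop
      (𝓝 (p.sum (x - x₀))) := by
    have h := ((p.hasSum hmem).tendsto_sum_nat).comp (Filter.tendsto_add_atTop_nat 1)
    refine h.congr fun n => ?_
    rw [taylor_within_apply]
    refine Finset.sum_congr rfl fun k _ => ?_
    simp [hp, smul_smul, mul_comm]
  exact tendsto_nhds_unique hlim1 hlim2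

/-- Smooth solutions of an autonomous analytic equation `x • γ' = Φ(γ)` on `[0, a]` have
derivatives of analytic growth. -/
theorem exists_iteratedDerivWithin_le_of_smul_derivWithin_eq [CompleteSpace V] {a : ℝ} (ha : 0 < a)
    {γ : ℝ → V} (hγ : ContDiffOn ℝ ∞ γ (Icc 0 a)) {Φ : V → V}
    (hΦ : AnalyticOnNhd ℝ Φ (γ '' Icc 0 a))
    (hode : ∀ x ∈ Icc 0 a, x • derivWithin γ (Icc 0 a) x = Φ (γ x)) :
    ∃ D R : ℝ, 0 < D ∧ 0 < R ∧
      ∀ j, ∀ x ∈ Icc 0 a, ‖iteratedDerivWithin j γ (Icc 0 a) x‖ ≤ D * j ! * R ^ j := by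
  have hs : UniqueDiffOn ℝ (Icc 0 a) := uniqueDiffOn_Icc ha
  obtain ⟨M, C, hM, hC, hq⟩ :=
    (isCompact_Icc.image_of_continuousOn hγ.continuousOn).exists_hasFPowerSeriesAt_norm_le hΦ
  have hmax : ∀ j, ∃ X ∈ Icc 0 a, ∀ x ∈ Icc 0 a,
      ‖iteratedDerivWithin j γ (Icc 0 a) x‖ ≤ ‖iteratedDerivWithin j γ (Icc 0 a) X‖ := fun j =>
    isCompact_Icc.exists_isMaxOn (nonempty_Icc.2 ha.le)
      (hγ.continuousOn_iteratedDerivWithin (mod_cast le_top) hs).norm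
  choose X hX hXmax using hmax
  set Y : ℕ → ℝ := fun j => ‖iteratedDerivWithin j γ (Icc 0 a) (X j)‖ / j ! with hYdef
  have hY : ∀ j, 0 ≤ Y j := fun j => by positivity
  have hrec : ∀ j : ℕ, j * Y j ≤
      ∑ c : Composition j, M * C ^ c.length * ∏ i, Y (c.blocksFun i) := by
    intro j
    have hfac : (0 : ℝ) < j ! := by positivity
    have hbound : ∀ x ∈ Icc 0 a, ‖iteratedDerivWithin j (Φ ∘ γ) (Icc 0 a) x‖ ≤
        j ! * ∑ c : Composition j, M * C ^ c.length * ∏ i, Y (c.blocksFun i) := by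
      intro x hx
      obtain ⟨q, hqx, hqn⟩ := hq (γ x) (mem_image_of_mem γ hx)
      refine (norm_iteratedDerivWithin_comp_le hs hx (hγ x hx) hqx j).trans ?_
      gcongr with c _ i
      · exact hqn _
      · exact div_le_div_of_nonneg_right (hXmax _ x hx) (Nat.cast_nonneg _)
    have h := mul_norm_le_of_smul_deriv_add_smul (j := j)
      (f := iteratedDerivWithin j γ (Icc 0 a)) (f' := iteratedDerivWithin (j + 1) γ (Icc 0 a))
      (h := iteratedDerivWithin j (Φ ∘ γ) (Icc 0 a)) ?_ ?_ hbound (hX j)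
    · rw [hYdef, ← mul_div_assoc, div_le_iff₀ hfac, mul_comm _ (j ! : ℝ)]
      exact h
    · intro x hx
      rw [iteratedDerivWithin_succ]
      exact (hγ.differentiableOn_iteratedDerivWithin (mod_cast ENat.natCast_lt_top j) hs x
        hx).hasDerivWithinAt
    · intro x hx
      have hc := iteratedDerivWithin_congr (n := j) (g := Φ ∘ γ) hode hx
      exact hc ▸ (iteratedDerivWithin_smul_derivWithin hs hγ j hx).symm
  obtain ⟨r, D, hr, hD, hYD⟩ := exists_mul_pow_le_of_composition_bound hY hM hC hrec
  refine ⟨D, r⁻¹, hD, by positivity, fun j x hx => (hXmax j x hx).trans ?_⟩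
  have h := hYD j
  rw [hYdef, div_mul_eq_mul_div, div_le_iff₀ (by positivity)] at h
  rw [inv_pow, ← div_eq_mul_inv, le_div_iff₀ (by positivity)]
  exact h

end BriotBouquet

/-- **Smooth solutions of a real Briot–Bouquet ODE are analytic.**
Consider `x·y'(x) = F(x,y(x))` on `[0,a]`, with `y` ℝⁿ-valued and `F` real-analytic on an
open neighborhood `Ω` of the graph of `y`. If `y` is `C∞` on `[0,a]`, then `y` is
real-analytic at every point of `[0,a]`: near each `x₀ ∈ [0,a]`, `y` coincides (on `[0,a]`)
with a function analytic at `x₀`, i.e. with a convergent power series in `x − x₀`. -/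
theorem stmt7 {n : ℕ} (hn : 1 ≤ n) (a : ℝ) (ha : 0 < a)
    (F : ℝ × EuclideanSpace ℝ (Fin n) → EuclideanSpace ℝ (Fin n))
    (Ω : Set (ℝ × EuclideanSpace ℝ (Fin n))) (hΩ : IsOpen Ω)
    (hF : AnalyticOnNhd ℝ F Ω)
    (y : ℝ → EuclideanSpace ℝ (Fin n))
    (hgraph : ∀ x ∈ Icc (0 : ℝ) a, (x, y x) ∈ Ω)
    (hy : ContDiffOn ℝ (⊤ : ℕ∞) y (Icc (0 : ℝ) a))
    (hode : ∀ x ∈ Icc (0 : ℝ) a, x • derivWithin y (Icc (0 : ℝ) a) x = F (x, y x)) :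
    ∀ x₀ ∈ Icc (0 : ℝ) a, ∃ g : ℝ → EuclideanSpace ℝ (Fin n),
      AnalyticAt ℝ g x₀ ∧ ∀ᶠ x in nhdsWithin x₀ (Icc (0 : ℝ) a), y x = g x := by
  have hs : UniqueDiffOn ℝ (Icc (0 : ℝ) a) := uniqueDiffOn_Icc ha
  have hγ : ContDiffOn ℝ ∞ (fun x => (x, y x)) (Icc (0 : ℝ) a) := contDiffOn_id.prodMk hy
  have hΦ : AnalyticOnNhd ℝ (fun v : ℝ × EuclideanSpace ℝ (Fin n) => (v.1, F v))
      ((fun x => (x, y x)) '' Icc (0 : ℝ) a) := by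
    rintro _ ⟨x, hx, rfl⟩
    exact analyticAt_fst.prod (hF _ (hgraph x hx))
  have hode' : ∀ x ∈ Icc (0 : ℝ) a,
      x • derivWithin (fun x => (x, y x)) (Icc (0 : ℝ) a) x = (x, F (x, y x)) := by
    intro x hx
    have hyd := ((hy.differentiableOn (by simp)) x hx).hasDerivWithinAt
    have hd : HasDerivWithinAt (fun x => (x, y x)) (1, derivWithin y (Icc (0 : ℝ) a) x)
        (Icc (0 : ℝ) a) x := (hasDerivWithinAt_id x _).prodMk hyd
    rw [hd.derivWithin (hs x hx), ← hode x hx]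
    simp
  obtain ⟨D, R, hD, hR, hb⟩ := exists_iteratedDerivWithin_le_of_smul_derivWithin_eq ha hγ hΦ hode'
  intro x₀ hx₀
  obtain ⟨g, hg, hgy⟩ :=
    exists_analyticAt_eventuallyEq_of_iteratedDerivWithin_le ha hγ hD hR hb hx₀
  exact ⟨fun x => (g x).2, analyticAt_snd.comp hg, hgy.mono fun x hx => congrArg Prod.snd hx⟩
end

section
/- Consider a first-order complex ODE x·y'(x) = F(x,y(x)) for x ∈ [0,a], where y is ℂⁿ-valued (n ≥ 1) and F is real-analytic (identifying ℂⁿ ≅ ℝ^{2n}) on an open neighborhood of the graph {(x,y(x)) : x ∈ [0,a]} ⊂ ℝ × ℂⁿ, with values in ℂⁿ. If y is a C∞ solution on [0,a], then y is real-analytic everywhere on [0,a]. -/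
open Set Filter Topology
open scoped ContDiff

section Pointwise

variable {V W : Type*} [NormedAddCommGroup V] [NormedSpace ℝ V] [NormedAddCommGroup W]
  [NormedSpace ℝ W]

/-- The pointwise action of a continuous multilinear map on spaces of continuous functions. -/
noncomputable def ContinuousMultilinearMap.pointwise (X : Type*) [TopologicalSpace X]
    [CompactSpace X] {n : ℕ} (m : ContinuousMultilinearMap ℝ (fun _ : Fin n => V) W) :
    ContinuousMultilinearMap ℝ (fun _ : Fin n => C(X, V)) C(X, W) :=
  MultilinearMap.mkContinuous
    { toFun := fun u => ⟨fun t => m fun i => u i t, by fun_prop⟩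
      map_update_add' := fun u i a b => by
        ext t
        have h : ∀ c : C(X, V), (fun j => Function.update u i c j t)
            = Function.update (fun j => u j t) i (c t) := fun c =>
          funext fun j => Function.apply_update (fun _ (c : C(X, V)) => c t) u i c j
        simp [h]
      map_update_smul' := fun u i a b => by
        ext t
        have h : ∀ c : C(X, V), (fun j => Function.update u i c j t)
            = Function.update (fun j => u j t) i (c t) := fun c =>
          funext fun j => Function.apply_update (fun _ (c : C(X, V)) => c t) u i c j
        simp [h] } ‖m‖ fun u => by
    refine (ContinuousMap.norm_le _ (by positivity)).2 fun t => ?_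
    refine (m.le_opNorm _).trans ?_
    gcongr with i
    exact (u i).norm_coe_le_norm t

theorem ContinuousMultilinearMap.pointwise_apply {X : Type*} [TopologicalSpace X]
    [CompactSpace X] {n : ℕ} (m : ContinuousMultilinearMap ℝ (fun _ : Fin n => V) W)
    (u : Fin n → C(X, V)) (t : X) : m.pointwise X u t = m fun i => u i t := rfl

theorem ContinuousMultilinearMap.norm_pointwise_le {X : Type*} [TopologicalSpace X]
    [CompactSpace X] {n : ℕ} (m : ContinuousMultilinearMap ℝ (fun _ : Fin n => V) W) :
    ‖m.pointwise X‖ ≤ ‖m‖ :=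
  MultilinearMap.mkContinuous_norm_le _ (norm_nonneg _) _

/-- The superposition operator of a function analytic at a point is analytic at the corresponding
constant function. -/
theorem AnalyticAt.exists_pointwise (X : Type*) [TopologicalSpace X] [CompactSpace X]
    [CompleteSpace W] {h : V → W} {v : V} (hh : AnalyticAt ℝ h v) :
    ∃ Ψ : C(X, V) → C(X, W), AnalyticAt ℝ Ψ (ContinuousMap.const X v) ∧
      ∀ᶠ u in 𝓝 (ContinuousMap.const X v), ∀ t, Ψ u t = h (u t) := by
  obtain ⟨p, r, hp⟩ := hh
  set P : FormalMultilinearSeries ℝ C(X, V) C(X, W) := fun n => (p n).pointwise X with hP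
  have hrad : p.radius ≤ P.radius :=
    FormalMultilinearSeries.radius_le_of_le fun n => (p n).norm_pointwise_le
  have hpos : 0 < P.radius := (hp.r_pos.trans_le hp.r_le).trans_le hrad
  have hPs := P.hasFPowerSeriesOnBall hpos
  refine ⟨fun u => P.sum (u - ContinuousMap.const X v), ?_, ?_⟩
  · have := hPs.comp_sub (ContinuousMap.const X v)
    rw [zero_add] at this
    exact this.analyticAt
  · have hball : Metric.eball (ContinuousMap.const X v) r ∈ 𝓝 (ContinuousMap.const X v) :=
      Metric.eball_mem_nhds _ hp.r_pos
    filter_upwards [hball] with u hu t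
    have hu' : u - ContinuousMap.const X v ∈ Metric.eball (0 : C(X, V)) r := by
      rw [Metric.mem_eball, edist_eq_enorm_sub] at hu
      simpa [Metric.mem_eball] using hu
    have hs := P.hasSum (Metric.eball_subset_eball (hp.r_le.trans hrad) hu')
    have hst := (ContinuousMap.evalCLM ℝ t : C(X, W) →L[ℝ] W).hasSum hs
    have hut : u t - v ∈ Metric.eball (0 : V) r := by
      rw [Metric.mem_eball, edist_zero_right] at hu' ⊢
      refine lt_of_le_of_lt ?_ hu'
      exact enorm_le_iff_norm_le.2 ((u - ContinuousMap.const X v).norm_coe_le_norm t)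
    have hst' := hp.hasSum hut
    rw [add_sub_cancel] at hst'
    exact hst.unique hst'

/-- First order factorization of an analytic function at a point. -/
theorem AnalyticAt.exists_eq_add_apply_sub [CompleteSpace W] {f : V → W} {p : V}
    (hf : AnalyticAt ℝ f p) :
    ∃ K : V → V →L[ℝ] W, AnalyticAt ℝ K 0 ∧ K 0 = fderiv ℝ f p ∧
      ∀ᶠ w in 𝓝 0, f (p + w) = f p + K w w := by
  obtain ⟨q, r, hq⟩ := hf
  have hpos : 0 < q.shift.radius := by
    rw [FormalMultilinearSeries.radius_shift]; exact hq.r_pos.trans_le hq.r_le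
  have hK := q.shift.hasFPowerSeriesOnBall hpos
  have hq' : q.shift.unshift (f p) = q := by
    ext1 n
    cases n with
    | zero =>
      ext v
      simpa [FormalMultilinearSeries.unshift] using (hq.coeff_zero v).symm
    | succ n => exact (continuousMultilinearCurryRightEquiv' ℝ n V W).symm_apply_apply (q (n + 1))
  have hun := hK.unshift (z := f p)
  rw [hq'] at hun
  have heq : ∀ᶠ w in 𝓝 0, f (p + w) = f p + q.shift.sum w w := by
    have hball : Metric.eball (0 : V) r ∈ 𝓝 0 := Metric.eball_mem_nhds _ hq.r_pos
    have hball' : Metric.eball (0 : V) q.shift.radius ∈ 𝓝 0 := Metric.eball_mem_nhds _ hpos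
    filter_upwards [hball, hball'] with w hw hw'
    have h2 := hun.hasSum hw'
    simp only [zero_add, sub_zero] at h2
    exact (hq.hasSum hw).unique h2
  refine ⟨q.shift.sum, hK.analyticAt, ?_, heq⟩
  rw [hq.hasFPowerSeriesAt.fderiv_eq]
  ext v
  rw [← hK.coeff_zero (fun i => i.elim0)]
  simp [FormalMultilinearSeries.shift]
  congr 1
  ext i
  simp [Fin.snoc]

end Pointwise

section Averaging

variable {E : Type*} [NormedAddCommGroup E] [NormedSpace ℝ E]

/-- The operator `v ↦ (t ↦ ∫₀¹ σ ^ k v (σ t) dσ)`, inverse to `x d/dx + (k + 1)`. -/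
noncomputable def weightedAverage (k : ℕ) :
    C(Icc (0 : ℝ) 1, E) →L[ℝ] C(Icc (0 : ℝ) 1, E) :=
  LinearMap.mkContinuous
    { toFun := fun v =>
        ⟨fun t => ∫ σ in (0 : ℝ)..1, σ ^ k • IccExtend zero_le_one v (σ * (t : ℝ)), by
          have := v.continuous.Icc_extend' (h := zero_le_one)
          apply intervalIntegral.continuous_parametric_intervalIntegral_of_continuous'
          fun_prop⟩
      map_add' := fun u v => by
        ext t
        have hu := u.continuous.Icc_extend' (h := zero_le_one)
        have hv := v.continuous.Icc_extend' (h := zero_le_one)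
        simp only [ContinuousMap.coe_mk, ContinuousMap.add_apply]
        rw [← intervalIntegral.integral_add]
        · simp [IccExtend]
        all_goals
          apply Continuous.intervalIntegrable
          fun_prop
      map_smul' := fun c v => by
        ext t
        simp only [ContinuousMap.coe_mk, ContinuousMap.smul_apply, RingHom.id_apply]
        rw [← intervalIntegral.integral_smul]
        simp [IccExtend, smul_comm c] } ((k : ℝ) + 1)⁻¹ fun v => by
    refine (ContinuousMap.norm_le _ (by positivity)).2 fun t => ?_
    have hb : ∀ᵐ σ : ℝ, σ ∈ Ioc (0 : ℝ) 1 →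
        ‖σ ^ k • IccExtend zero_le_one v (σ * (t : ℝ))‖ ≤ σ ^ k * ‖v‖ := by
      refine Filter.Eventually.of_forall fun σ hσ => ?_
      rw [norm_smul, Real.norm_of_nonneg (pow_nonneg hσ.1.le k)]
      exact mul_le_mul_of_nonneg_left (v.norm_coe_le_norm _) (pow_nonneg hσ.1.le k)
    refine (intervalIntegral.norm_integral_le_of_norm_le zero_le_one hb
      (by apply Continuous.intervalIntegrable; fun_prop)).trans_eq ?_
    rw [intervalIntegral.integral_mul_const, integral_pow]
    simp

theorem weightedAverage_apply (k : ℕ) (v : C(Icc (0 : ℝ) 1, E)) (t : Icc (0 : ℝ) 1) :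
    weightedAverage k v t = ∫ σ in (0 : ℝ)..1, σ ^ k • IccExtend zero_le_one v (σ * (t : ℝ)) :=
  rfl

theorem norm_weightedAverage_le (k : ℕ) :
    ‖(weightedAverage k : C(Icc (0 : ℝ) 1, E) →L[ℝ] _)‖ ≤ ((k : ℝ) + 1)⁻¹ :=
  LinearMap.mkContinuous_norm_le _ (by positivity) _

variable [CompleteSpace E]

theorem integral_pow_smul_eq_of_hasDerivAt {k : ℕ} {Y G : ℝ → E}
    (hY : ContinuousOn Y (Icc 0 1)) (hG : ContinuousOn G (Icc 0 1))
    (h : ∀ t ∈ Ioo (0 : ℝ) 1, ∃ Y', HasDerivAt Y Y' t ∧ ((k : ℝ) + 1) • Y t + t • Y' = G t) :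
    ∫ t in (0 : ℝ)..1, t ^ k • G t = Y 1 := by
  have key := intervalIntegral.integral_eq_sub_of_hasDerivAt_of_le (zero_le_one' ℝ)
    (f := fun t => t ^ (k + 1) • Y t) (f' := fun t => t ^ k • G t)
    (by fun_prop) (fun t ht => by
      obtain ⟨Y', hY', e⟩ := h t ht
      have := (hasDerivAt_pow (k + 1) t).smul hY'
      convert! this using 1
      rw [← e]
      simp only [Nat.add_sub_cancel, smul_add, smul_smul, Nat.cast_add, Nat.cast_one]
      rw [add_comm, pow_succ, mul_comm (t ^ k) ((k : ℝ) + 1)])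
    (by
      apply ContinuousOn.intervalIntegrable
      rw [uIcc_of_le zero_le_one]
      fun_prop)
  simpa using key

end Averaging

section Solutions

variable {E : Type*} [NormedAddCommGroup E] [NormedSpace ℝ E]

/-- `y` is a solution near `0`, within `s`, of the Briot–Bouquet equation `x y' = F (x, y)`. -/
structure IsBriotBouquetSolution (s : Set ℝ) (F : ℝ × E → E) (y : ℝ → E) : Prop where
  continuousWithinAt : ContinuousWithinAt y s 0
  eventually_hasDerivWithinAt : ∀ᶠ x in 𝓝[s] 0, x ≠ 0 →
    ∃ y', HasDerivWithinAt y y' s x ∧ x • y' = F (x, y x)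

theorem StarConvex.eventually_forall_mul {s : Set ℝ} (hs : StarConvex ℝ 0 s) {P : ℝ → Prop}
    (h : ∀ᶠ x in 𝓝[s] 0, P x) : ∀ᶠ x in 𝓝[s] 0, ∀ t ∈ Icc (0 : ℝ) 1, P (t * x) := by
  rw [eventually_nhdsWithin_iff, Metric.eventually_nhds_iff] at h ⊢
  obtain ⟨ε, hε, h⟩ := h
  refine ⟨ε, hε, fun x hx hxs t ht => h ?_ (hs.smul_mem hxs ht.1 ht.2)⟩
  rw [dist_zero_right, norm_mul, Real.norm_of_nonneg ht.1] at *
  exact (mul_le_of_le_one_left (norm_nonneg x) ht.2).trans_lt (by simpa using hx)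

namespace IsBriotBouquetSolution

variable {s : Set ℝ} {F : ℝ × E → E} {y : ℝ → E}

theorem tendsto_graph (h : IsBriotBouquetSolution s F y) :
    Tendsto (fun x => (x, y x)) (𝓝[s] 0) (𝓝 (0, y 0)) :=
  (continuousWithinAt_id.prodMk h.continuousWithinAt).tendsto

theorem eventually_continuousOn (h : IsBriotBouquetSolution s F y) (hs : StarConvex ℝ 0 s) :
    ∀ᶠ x in 𝓝[s] 0, ContinuousOn (fun t => y (t * x)) (Icc 0 1) := by
  filter_upwards [hs.eventually_forall_mul h.eventually_hasDerivWithinAt, self_mem_nhdsWithin]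
    with x hx hxs
  have hmaps : MapsTo (fun t : ℝ => t * x) (Icc 0 1) s := fun t ht => hs.smul_mem hxs ht.1 ht.2
  have hc : ContinuousOn y ((fun t : ℝ => t * x) '' Icc 0 1) := by
    rintro _ ⟨t, ht, rfl⟩
    refine ContinuousWithinAt.mono ?_ hmaps.image_subset
    by_cases h0 : t * x = 0
    · simpa only [h0] using h.continuousWithinAt
    · obtain ⟨y', hy', -⟩ := hx t ht h0
      exact hy'.continuousWithinAt
  exact hc.comp (by fun_prop) (mapsTo_image _ _)

theorem eventually_continuousOn_comp {Z : Type*} [TopologicalSpace Z] {Q : ℝ × E → Z}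
    (h : IsBriotBouquetSolution s F y)
    (hs : StarConvex ℝ 0 s) (hQ : ∀ᶠ p in 𝓝 (0, y 0), ContinuousAt Q p) :
    ∀ᶠ x in 𝓝[s] 0, ContinuousOn (fun t => Q (t * x, y (t * x))) (Icc 0 1) := by
  filter_upwards [h.eventually_continuousOn hs,
    hs.eventually_forall_mul (h.tendsto_graph.eventually hQ)] with x hx hQx
  intro t ht
  have h1 : ContinuousWithinAt (fun t => (t * x, y (t * x))) (Icc 0 1) t :=
    ContinuousWithinAt.prodMk (by fun_prop) (hx t ht)
  exact ContinuousAt.comp_continuousWithinAt (f := fun t => (t * x, y (t * x))) (hQx t ht) h1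

variable [CompleteSpace E]

theorem eventually_integral_eq (h : IsBriotBouquetSolution s F y) (hs : StarConvex ℝ 0 s)
    (hF : ∀ᶠ p in 𝓝 (0, y 0), ContinuousAt F p) (k : ℕ) :
    ∀ᶠ x in 𝓝[s] 0, x ≠ 0 → ∫ t in (0 : ℝ)..1,
      t ^ k • (((k : ℝ) + 1) • y (t * x) + F (t * x, y (t * x))) = y x := by
  filter_upwards [h.eventually_continuousOn hs, h.eventually_continuousOn_comp hs hF,
    hs.eventually_forall_mul h.eventually_hasDerivWithinAt, self_mem_nhdsWithin]
    with x hy hFy hx hxs hx0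
  have := integral_pow_smul_eq_of_hasDerivAt (k := k) (Y := fun t => y (t * x))
    (G := fun t => ((k : ℝ) + 1) • y (t * x) + F (t * x, y (t * x))) hy
    ((hy.const_smul _).add hFy) ?_
  · simpa using this
  intro t ht
  obtain ⟨y', hy', e⟩ := hx t (Ioo_subset_Icc_self ht) (mul_ne_zero ht.1.ne' hx0)
  have hd : HasDerivWithinAt (fun t : ℝ => t * x) x (Ioo 0 1) t := by
    simpa using (hasDerivWithinAt_id t (Ioo 0 1)).mul_const x
  refine ⟨x • y', (HasDerivWithinAt.scomp t hy' hd fun t ht =>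
    hs.smul_mem hxs ht.1.le ht.2.le).hasDerivAt (Ioo_mem_nhds ht.1 ht.2), ?_⟩
  rw [smul_smul, e]

theorem apply_eq_zero (h : IsBriotBouquetSolution s F y) (hs : StarConvex ℝ 0 s)
    [(𝓝[s \ {0}] (0 : ℝ)).NeBot] (hF : ∀ᶠ p in 𝓝 (0, y 0), ContinuousAt F p) :
    F (0, y 0) = 0 := by
  have hFc : ContinuousAt F (0, y 0) := hF.self_of_nhds
  have hle : 𝓝[s \ {0}] (0 : ℝ) ≤ 𝓝[s] 0 := nhdsWithin_mono _ sdiff_subset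
  have hQ : Tendsto (fun x => y x + F (x, y x)) (𝓝[s] 0) (𝓝 (y 0 + F (0, y 0))) :=
    h.continuousWithinAt.tendsto.add (hFc.tendsto.comp h.tendsto_graph)
  have hlim : Tendsto y (𝓝[s \ {0}] 0) (𝓝 (y 0 + F (0, y 0))) := by
    rw [Metric.tendsto_nhds]
    intro ε hε
    have h1 := hs.eventually_forall_mul (hQ.eventually (Metric.ball_mem_nhds _ (half_pos hε)))
    filter_upwards [hle (h.eventually_integral_eq hs hF 0), hle h1,
      hle (h.eventually_continuousOn hs), hle (h.eventually_continuousOn_comp hs hF),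
      self_mem_nhdsWithin] with x hx hx1 hyc hFyc hxs
    have e := hx hxs.2
    simp only [pow_zero, one_smul, Nat.cast_zero, zero_add] at e
    have hi : IntervalIntegrable (fun t => y (t * x) + F (t * x, y (t * x)))
        MeasureTheory.volume 0 1 := by
      apply ContinuousOn.intervalIntegrable
      rw [uIcc_of_le zero_le_one]
      exact hyc.add hFyc
    have e2 : y x - (y 0 + F (0, y 0)) = ∫ t in (0 : ℝ)..1,
        (y (t * x) + F (t * x, y (t * x)) - (y 0 + F (0, y 0))) := by
      rw [intervalIntegral.integral_sub hi (by simp), e]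
      simp
    rw [dist_eq_norm, e2]
    refine (intervalIntegral.norm_integral_le_of_norm_le_const (C := ε / 2) fun t ht => ?_).trans_lt
      (by simpa using by linarith)
    rw [uIoc_of_le zero_le_one] at ht
    have := hx1 t (Ioc_subset_Icc_self ht)
    rw [← dist_eq_norm]
    exact this.le
  have := tendsto_nhds_unique hlim (h.continuousWithinAt.tendsto.mono_left hle)
  simpa using this

end IsBriotBouquetSolution

end Solutions

namespace IsBriotBouquetSolution

variable {E : Type*} [NormedAddCommGroup E] [NormedSpace ℝ E]
  {s : Set ℝ} {F : ℝ × E → E} {y : ℝ → E}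

/-- The rescaled solutions `t ↦ y (t x)`, as elements of the space of continuous functions. -/
theorem exists_rescale (h : IsBriotBouquetSolution s F y) (hs : StarConvex ℝ 0 s) :
    ∃ u : ℝ → C(Icc (0 : ℝ) 1, E), u 0 = ContinuousMap.const _ (y 0) ∧
      Tendsto u (𝓝[s] 0) (𝓝 (ContinuousMap.const _ (y 0))) ∧
      ∀ᶠ x in 𝓝[s] 0, ∀ t, u x t = y (t * x) := by
  classical
  let u : ℝ → C(Icc (0 : ℝ) 1, E) := fun x =>
    if hx : Continuous fun t : Icc (0 : ℝ) 1 => y (t * x) then ⟨_, hx⟩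
    else ContinuousMap.const _ (y 0)
  have hu : ∀ᶠ x in 𝓝[s] 0, ∀ t, u x t = y (t * x) := by
    filter_upwards [h.eventually_continuousOn hs] with x hx t
    have hx' : Continuous fun t : Icc (0 : ℝ) 1 => y (t * x) :=
      continuousOn_iff_continuous_domRestrict.1 hx
    simp [u, hx']
  refine ⟨u, ?_, ?_, hu⟩
  · ext t
    simp [u, continuous_const]
  · rw [Metric.tendsto_nhds]
    intro ε hε
    filter_upwards [hu, hs.eventually_forall_mul (h.continuousWithinAt.eventually
      (Metric.ball_mem_nhds _ hε))] with x hx hx'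
    refine (ContinuousMap.dist_lt_iff hε).2 fun t => ?_
    rw [hx]
    exact hx' t t.2

variable [CompleteSpace E]

/-- A version of `eventually_integral_eq` that includes the point `0`. -/
theorem eventually_integral_eq' (h : IsBriotBouquetSolution s F y) (hs : StarConvex ℝ 0 s)
    [(𝓝[s \ {0}] (0 : ℝ)).NeBot] (hF : ∀ᶠ p in 𝓝 (0, y 0), ContinuousAt F p) (k : ℕ) :
    ∀ᶠ x in 𝓝[s] 0, ∫ t in (0 : ℝ)..1,
      t ^ k • (((k : ℝ) + 1) • y (t * x) + F (t * x, y (t * x))) = y x := by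
  filter_upwards [h.eventually_integral_eq hs hF k] with x hx
  rcases eq_or_ne x 0 with rfl | hx0
  · simp only [mul_zero, h.apply_eq_zero hs hF, add_zero]
    rw [intervalIntegral.integral_smul_const, integral_pow, smul_smul]
    have : (k : ℝ) + 1 ≠ 0 := by positivity
    simp [this]
  · exact hx hx0

/-- A solution is analytic when the linear part of the equation is a negative multiple of the
identity up to a smaller perturbation. -/
theorem exists_analyticAt_of_norm_lt (h : IsBriotBouquetSolution s F y) (hs : StarConvex ℝ 0 s)
    (h0 : (0 : ℝ) ∈ s) [(𝓝[s \ {0}] (0 : ℝ)).NeBot] (hF : AnalyticAt ℝ F (0, y 0)) (k : ℕ)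
    {B : E →L[ℝ] E} (hB : ∀ v, fderiv ℝ F (0, y 0) (0, v) = B v - ((k : ℝ) + 1) • v)
    (hBk : ‖B‖ < (k : ℝ) + 1) :
    ∃ g : ℝ → E, AnalyticAt ℝ g 0 ∧ ∀ᶠ x in 𝓝[s] 0, y x = g x := by
  let I := Icc (0 : ℝ) 1
  have hFc : ∀ᶠ p in 𝓝 (0, y 0), ContinuousAt F p :=
    hF.eventually_analyticAt.mono fun _ hp => hp.continuousAt
  set Q : ℝ × E → E := fun p => ((k : ℝ) + 1) • p.2 + F p with hQdef
  have hQ : AnalyticAt ℝ Q (0, y 0) := (analyticAt_snd.const_smul (c := (k : ℝ) + 1)).add hF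
  have hQ' : ∀ v, fderiv ℝ Q (0, y 0) (0, v) = B v := fun v => by
    have := (hasFDerivAt_snd.const_smul ((k : ℝ) + 1)).add hF.differentiableAt.hasFDerivAt
    rw [HasFDerivAt.fderiv (f := Q) this]
    simp [hB]
  obtain ⟨Ψ, hΨ, hΨQ⟩ := hQ.exists_pointwise I
  let ι : C(I, ℝ × E) := ⟨fun t => ((t : ℝ), 0), by fun_prop⟩
  let J : ℝ × C(I, E) →L[ℝ] C(I, ℝ × E) :=
    (ContinuousLinearMap.fst ℝ ℝ C(I, E)).smulRight ι +
      ((ContinuousLinearMap.inr ℝ ℝ E).compLeftContinuous ℝ I).comp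
        (ContinuousLinearMap.snd ℝ ℝ C(I, E))
  have hJ : ∀ x u t, J (x, u) t = (x * t, u t) := fun x u t => by simp [J, ι]
  have hJ0 : J (0, ContinuousMap.const I (y 0)) = ContinuousMap.const I (0, y 0) := by
    ext1 t; simp [hJ]
  set u₀ := ContinuousMap.const I (y 0) with hu₀
  let A : C(I, E) →L[ℝ] C(I, E) := weightedAverage k
  let T : ℝ × C(I, E) → C(I, E) := fun p => p.2 - A (Ψ (J p))
  have hΨJ : AnalyticAt ℝ (fun p => Ψ (J p)) (0, u₀) :=
    AnalyticAt.comp (g := Ψ) (f := J) (by rwa [hJ0]) (J.analyticAt _)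
  have hT : AnalyticAt ℝ T (0, u₀) :=
    analyticAt_snd.sub ((A.analyticAt _).comp hΨJ)
  have hΨ' : ∀ w t, fderiv ℝ Ψ (ContinuousMap.const I (0, y 0)) w t
      = fderiv ℝ Q (0, y 0) (w t) := fun w t => by
    have h1 := (ContinuousMap.evalCLM ℝ t : C(I, E) →L[ℝ] E).hasFDerivAt.comp _
      hΨ.differentiableAt.hasFDerivAt
    have h2 : HasFDerivAt (fun u : C(I, ℝ × E) => Q (u t)) _ (ContinuousMap.const I (0, y 0)) :=
      HasFDerivAt.comp (g := Q) (f := fun u : C(I, ℝ × E) => u t) _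
        (hQ.differentiableAt.hasFDerivAt)
        (ContinuousMap.evalCLM ℝ t : C(I, ℝ × E) →L[ℝ] ℝ × E).hasFDerivAt
    have h3 := h1.unique (h2.congr_of_eventuallyEq (hΨQ.mono fun u hu => hu t))
    exact DFunLike.congr_fun h3 w
  let R : C(I, E) →L[ℝ] C(I, E) := A ∘L fderiv ℝ Ψ (ContinuousMap.const I (0, y 0)) ∘L
    J ∘L ContinuousLinearMap.inr ℝ ℝ C(I, E)
  have hR : ‖R‖ < 1 := by
    have hk : (0 : ℝ) < (k : ℝ) + 1 := by positivity
    have h1 : ‖fderiv ℝ Ψ (ContinuousMap.const I (0, y 0)) ∘L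
        J ∘L ContinuousLinearMap.inr ℝ ℝ C(I, E)‖ ≤ ‖B‖ := by
      refine ContinuousLinearMap.opNorm_le_bound _ (norm_nonneg _) fun u => ?_
      refine (ContinuousMap.norm_le _ (by positivity)).2 fun t => ?_
      simp only [ContinuousLinearMap.comp_apply, ContinuousLinearMap.inr_apply]
      rw [hΨ', hJ, zero_mul, hQ']
      exact (B.le_opNorm _).trans (by gcongr; exact u.norm_coe_le_norm t)
    calc ‖R‖ ≤ ‖A‖ * ‖B‖ := (ContinuousLinearMap.opNorm_comp_le _ _).trans (by gcongr)
      _ ≤ ((k : ℝ) + 1)⁻¹ * ‖B‖ := by gcongr; exact norm_weightedAverage_le k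
      _ < ((k : ℝ) + 1)⁻¹ * ((k : ℝ) + 1) := by gcongr
      _ = 1 := inv_mul_cancel₀ hk.ne'
  have hT' : fderiv ℝ T (0, u₀) ∘L ContinuousLinearMap.inr ℝ ℝ C(I, E) = 1 - R := by
    have h1 : HasFDerivAt Ψ (fderiv ℝ Ψ (ContinuousMap.const I (0, y 0))) (J (0, u₀)) := by
      rw [hJ0]; exact hΨ.differentiableAt.hasFDerivAt
    have h2 : HasFDerivAt T _ (0, u₀) :=
      hasFDerivAt_snd.sub (A.hasFDerivAt.comp _ (h1.comp _ J.hasFDerivAt))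
    rw [h2.fderiv]
    ext1 u
    simp [R]
  have hinv : (fderiv ℝ T (0, u₀) ∘L ContinuousLinearMap.inr ℝ ℝ C(I, E)).IsInvertible := by
    rw [hT']
    obtain ⟨e, he⟩ := isUnit_one_sub_of_norm_lt_one (R := C(I, E) →L[ℝ] C(I, E)) hR
    exact ⟨ContinuousLinearEquiv.ofUnit e, he⟩
  have hTω : ContDiffAt ℝ ω T (0, u₀) := hT.contDiffAt
  have hω : (ω : WithTop ℕ∞) ≠ 0 := by simp
  obtain ⟨u, hu0, hulim, hu⟩ := h.exists_rescale hs
  have hTu : ∀ᶠ x in 𝓝[s] 0, T (x, u x) = 0 := by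
    have hlim : Tendsto (fun x => J (x, u x)) (𝓝[s] 0) (𝓝 (ContinuousMap.const I (0, y 0))) := by
      rw [← hJ0]
      exact (J.continuous.tendsto _).comp
        ((tendsto_nhdsWithin_of_tendsto_nhds tendsto_id).prodMk_nhds hulim)
    filter_upwards [hu, hlim.eventually hΨQ,
      hs.eventually_forall_mul (h.eventually_integral_eq' hs hFc k)] with x hux hΨx hx
    ext t
    simp only [T, ContinuousMap.sub_apply, ContinuousMap.zero_apply, sub_eq_zero]
    rw [weightedAverage_apply, hux, ← hx t t.2]
    refine intervalIntegral.integral_congr fun σ hσ => ?_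
    rw [uIcc_of_le zero_le_one] at hσ
    have hσt : σ * (t : ℝ) ∈ Icc (0 : ℝ) 1 :=
      ⟨mul_nonneg hσ.1 t.2.1, mul_le_one₀ hσ.2 t.2.1 t.2.2⟩
    simp only [IccExtend_of_mem _ _ hσt, hΨx, hJ, hux, hQdef]
    ring_nf
  have hT0 : T (0, u₀) = 0 := by
    simpa [hu0] using hTu.self_of_nhdsWithin h0
  refine ⟨fun x => hTω.implicitFunction hω hinv x ⟨1, zero_le_one, le_rfl⟩, ?_, ?_⟩
  · have h1 : AnalyticAt ℝ (hTω.implicitFunction hω hinv) 0 :=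
      (hTω.contDiffAt_implicitFunction hω hinv).analyticAt
    exact ((ContinuousMap.evalCLM ℝ (⟨1, zero_le_one, le_rfl⟩ : I) : C(I, E) →L[ℝ] E).analyticAt _).comp h1
  · have hlim : Tendsto (fun x => (x, u x)) (𝓝[s] 0) (𝓝 (0, u₀)) :=
      (tendsto_nhdsWithin_of_tendsto_nhds tendsto_id).prodMk_nhds hulim
    filter_upwards [hlim.eventually (hTω.eventually_apply_eq_iff_implicitFunction hω hinv),
      hTu, hu] with x hx hTx hux
    rw [hx.1 (hTx.trans hT0.symm), hux]
    simp

end IsBriotBouquetSolution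

section Blowup

variable {E : Type*} [NormedAddCommGroup E] [NormedSpace ℝ E]

/-- `HasExpansion s k y`: the function `y` has an expansion of order `k` at `0` within `s`,
with a continuous remainder. -/
def HasExpansion (s : Set ℝ) : ℕ → (ℝ → E) → Prop
  | 0, y => ContinuousWithinAt y s 0
  | k + 1, y => ∃ (c : E) (z : ℝ → E), HasExpansion s k z ∧ ∀ x ∈ s, y x = c + x • z x

theorem HasExpansion.continuousWithinAt {s : Set ℝ} (h0 : (0 : ℝ) ∈ s) {k : ℕ} {y : ℝ → E}
    (h : HasExpansion s k y) : ContinuousWithinAt y s 0 := by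
  induction k generalizing y with
  | zero => exact h
  | succ k ih =>
    obtain ⟨c, z, hz, e⟩ := h
    have : ContinuousWithinAt (fun x => c + x • z x) s 0 :=
      continuousWithinAt_const.add (continuousWithinAt_id.smul (ih hz))
    exact this.congr e (e 0 h0)

theorem HasExpansion.of_eq_sum {s : Set ℝ} {k : ℕ} {y ρ : ℝ → E} {c : ℕ → E}
    (h0 : (0 : ℝ) ∈ s) (hρ : ContinuousWithinAt ρ s 0)
    (h : ∀ x ∈ s, y x = ∑ i ∈ Finset.range k, x ^ i • c i + x ^ k • ρ x) :
    HasExpansion s k y := by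
  induction k generalizing y c with
  | zero =>
    exact hρ.congr (fun x hx => by simpa using h x hx) (by simpa using h 0 h0)
  | succ k ih =>
    refine ⟨c 0, _, ih (y := fun x => ∑ i ∈ Finset.range k, x ^ i • c (i + 1) + x ^ k • ρ x)
      (fun x _ => rfl), fun x hx => ?_⟩
    rw [h x hx, Finset.sum_range_succ']
    simp only [smul_add, Finset.smul_sum, smul_smul, pow_succ', pow_zero, one_smul]
    abel

theorem ContDiffOn.hasExpansion {s : Set ℝ} (hs : Convex ℝ s) (h0 : (0 : ℝ) ∈ s) {k : ℕ}
    {y : ℝ → E} (hy : ContDiffOn ℝ k y s) : HasExpansion s k y := by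
  set c : ℕ → E := fun i => (i.factorial : ℝ)⁻¹ • iteratedDerivWithin i y s 0 with hc
  set r : ℝ → E := fun x => (x ^ k)⁻¹ • (y x - taylorWithinEval y k s 0 x) with hr
  have hT : ∀ x, taylorWithinEval y k s 0 x = ∑ i ∈ Finset.range k, x ^ i • c i + x ^ k • c k := by
    intro x
    rw [taylor_within_apply, Finset.sum_range_succ]
    simp [hc, smul_smul, mul_comm]
  have hr0 : r 0 = 0 := by simp [hr]
  refine HasExpansion.of_eq_sum h0 (c := c) (ρ := fun x => c k + r x) ?_ fun x hx => ?_
  · refine continuousWithinAt_const.add ?_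
    have := taylor_tendsto hs h0 hy
    simp only [sub_zero] at this
    rw [ContinuousWithinAt, hr0]
    exact this
  · rw [smul_add, ← add_assoc, ← hT]
    rcases eq_or_ne x 0 with rfl | hx0
    · simp [hr0]
    · simp [hr, smul_smul, hx0]

variable [CompleteSpace E] {s : Set ℝ}

/-- A solution having an expansion of sufficiently high order is analytic. -/
theorem IsBriotBouquetSolution.exists_analyticAt_of_hasExpansion (hs : StarConvex ℝ 0 s)
    (h0 : (0 : ℝ) ∈ s) [(𝓝[s \ {0}] (0 : ℝ)).NeBot] {k : ℕ} : ∀ {m : ℕ} {F : ℝ × E → E}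
    {y : ℝ → E} {B : E →L[ℝ] E}, IsBriotBouquetSolution s F y → AnalyticAt ℝ F (0, y 0) →
    HasExpansion s k y → (∀ v, fderiv ℝ F (0, y 0) (0, v) = B v - (m : ℝ) • v) →
    ‖B‖ < m + k → ∃ g : ℝ → E, AnalyticAt ℝ g 0 ∧ ∀ᶠ x in 𝓝[s] 0, y x = g x := by
  induction k with
  | zero =>
    intro m F y B h hF hy hB hm
    obtain _ | m := m
    · exact absurd hm (by simp)
    · exact h.exists_analyticAt_of_norm_lt hs h0 hF m (by simpa using hB) (by simpa using hm)
  | succ k ih =>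
    intro m F y B h hF hy hB hm
    obtain ⟨c, z, hz, e⟩ := hy
    have hc : y 0 = c := by simpa using e 0 h0
    have hzc := hz.continuousWithinAt h0
    have hF0 : F (0, y 0) = 0 :=
      h.apply_eq_zero hs (hF.eventually_analyticAt.mono fun _ hp => hp.continuousAt)
    obtain ⟨K, hK, hK0, hFK⟩ := hF.exists_eq_add_apply_sub
    set G : ℝ × E → E := fun p => K (p.1, p.1 • p.2) (1, p.2) - p.2 with hG
    have hKc : ∀ v, AnalyticAt ℝ (fun p : ℝ × E => K (p.1, p.1 • p.2)) (0, v) := fun v =>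
      AnalyticAt.comp (g := K) (f := fun p : ℝ × E => (p.1, p.1 • p.2)) (by simpa only [zero_smul, Prod.mk_zero_zero] using hK)
        (analyticAt_fst.prod (analyticAt_fst.smul analyticAt_snd))
    have hGa : AnalyticAt ℝ G (0, z 0) :=
      (((ContinuousLinearMap.id ℝ (ℝ × E →L[ℝ] E)).analyticAt_bilinear _).comp
        ((hKc _).prod (analyticAt_const.prod analyticAt_snd))).sub analyticAt_snd
    have hG' : ∀ v, fderiv ℝ G (0, z 0) (0, v) = B v - ((m + 1 : ℕ) : ℝ) • v := fun v => by
      have h1 : HasFDerivAt (fun v => G (0, v)) _ (z 0) :=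
        HasFDerivAt.comp (g := G) (z 0) hGa.differentiableAt.hasFDerivAt
          (hasFDerivAt_prodMk_right (0 : ℝ) (z 0))
      have h2 : (fun v => G (0, v)) = fun v => K 0 (1, 0) + (B v - ((m + 1 : ℕ) : ℝ) • v) := by
        ext v
        have : ((1 : ℝ), v) = (1, 0) + (0, v) := by simp
        simp only [hG, zero_smul, Prod.mk_zero_zero]
        rw [this, map_add, hK0, hB]
        push_cast
        module
      rw [h2] at h1
      have h3 : HasFDerivAt (fun v => K 0 (1, 0) + (B v - ((m + 1 : ℕ) : ℝ) • v)) _ (z 0) :=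
        (B.hasFDerivAt.sub ((hasFDerivAt_id (z 0)).const_smul ((m + 1 : ℕ) : ℝ))).const_add _
      simpa using DFunLike.congr_fun (h1.unique h3) v
    have hzsol : IsBriotBouquetSolution s G z := by
      refine ⟨hzc, ?_⟩
      have hlim : Tendsto (fun x => (x, x • z x)) (𝓝[s] 0) (𝓝 (0, 0)) := by
        have : ContinuousWithinAt (fun x => (x, x • z x)) s 0 :=
          continuousWithinAt_id.prodMk (continuousWithinAt_id.smul hzc)
        simpa [ContinuousWithinAt] using this
      filter_upwards [h.eventually_hasDerivWithinAt, hlim.eventually hFK, self_mem_nhdsWithin]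
        with x hx hFx hxs hx0
      obtain ⟨y', hy', hode⟩ := hx hx0
      have hzeq : ∀ x ∈ s \ {0}, z x = x⁻¹ • (y x - c) := fun x hx => by
        rw [e x hx.1, add_sub_cancel_left, smul_smul, inv_mul_cancel₀ hx.2, one_smul]
      have hd : HasDerivWithinAt (fun x => x⁻¹ • (y x - c)) _ s x :=
        (hasDerivAt_inv hx0).hasDerivWithinAt.smul (hy'.sub_const c)
      have hd' := (hd.mono (sdiff_subset (t := {0}))).congr hzeq (hzeq x ⟨hxs, hx0⟩)
      have hd'' := hd'.mono_of_mem_nhdsWithin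
        (inter_mem_nhdsWithin s (compl_singleton_mem_nhds hx0))
      refine ⟨_, hd'', ?_⟩
      have hy'K : y' = K (x, x • z x) (1, z x) := by
        have h1 : ((0 : ℝ), y 0) + (x, x • z x) = (x, y x) := by simp [e x hxs, hc]
        have h2 : (x, x • z x) = x • ((1 : ℝ), z x) := by simp
        rw [h1, hF0, zero_add, ← hode] at hFx
        nth_rewrite 2 [h2] at hFx
        rw [map_smul] at hFx
        exact smul_right_injective E hx0 hFx
      have hxx : x * -(x ^ 2)⁻¹ = -x⁻¹ := by field_simp
      simp only [hG]
      rw [← hy'K, hzeq x ⟨hxs, hx0⟩, smul_add, smul_smul, smul_smul, mul_inv_cancel₀ hx0, one_smul,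
        hxx, neg_smul, ← sub_eq_add_neg]
    obtain ⟨g, hg, hgz⟩ := ih (m := m + 1) hzsol hGa hz hG' (by push_cast at hm ⊢; linarith)
    refine ⟨fun x => c + x • g x, analyticAt_const.add (analyticAt_id.smul hg), ?_⟩
    filter_upwards [hgz, self_mem_nhdsWithin] with x hx hxs
    rw [e x hxs, hx]

end Blowup

/-- Smooth solutions of a Briot–Bouquet equation are analytic at the singular point. -/
theorem IsBriotBouquetSolution.exists_analyticAt {E : Type*} [NormedAddCommGroup E]
    [NormedSpace ℝ E] [CompleteSpace E] {s : Set ℝ} {F : ℝ × E → E} {y : ℝ → E}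
    (h : IsBriotBouquetSolution s F y) (hs : Convex ℝ s) (h0 : (0 : ℝ) ∈ s)
    [(𝓝[s \ {0}] (0 : ℝ)).NeBot] (hF : AnalyticAt ℝ F (0, y 0))
    (hy : ContDiffOn ℝ (⊤ : ℕ∞) y s) :
    ∃ g : ℝ → E, AnalyticAt ℝ g 0 ∧ ∀ᶠ x in 𝓝[s] 0, y x = g x := by
  let B : E →L[ℝ] E := fderiv ℝ F (0, y 0) ∘L ContinuousLinearMap.inr ℝ ℝ E
  obtain ⟨k, hk⟩ := exists_nat_gt ‖B‖
  have hy' : ContDiffOn ℝ k y s := hy.of_le (by exact_mod_cast le_top)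
  exact exists_analyticAt_of_hasExpansion (hs.starConvex h0) h0 (m := 0) (B := B) h hF
    (hy'.hasExpansion hs h0) (fun v => by simp [B]) (by simpa using hk)

/-- **Smooth solutions of a complex Briot–Bouquet ODE are analytic.**
Consider `x·y'(x) = F(x,y(x))` on `[0,a]`, with `y` ℂⁿ-valued and `F` real-analytic
(identifying `ℂⁿ ≅ ℝ^{2n}`) on an open neighborhood `Ω` of the graph of `y`. If `y` is
`C∞` on `[0,a]`, then `y` is real-analytic at every point of `[0,a]`. -/
theorem stmt8 {n : ℕ} (hn : 1 ≤ n) (a : ℝ) (ha : 0 < a)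
    (F : ℝ × EuclideanSpace ℂ (Fin n) → EuclideanSpace ℂ (Fin n))
    (Ω : Set (ℝ × EuclideanSpace ℂ (Fin n))) (hΩ : IsOpen Ω)
    (hF : AnalyticOnNhd ℝ F Ω)
    (y : ℝ → EuclideanSpace ℂ (Fin n))
    (hgraph : ∀ x ∈ Icc (0 : ℝ) a, (x, y x) ∈ Ω)
    (hy : ContDiffOn ℝ (⊤ : ℕ∞) y (Icc (0 : ℝ) a))
    (hode : ∀ x ∈ Icc (0 : ℝ) a, x • derivWithin y (Icc (0 : ℝ) a) x = F (x, y x)) :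
    ∀ x₀ ∈ Icc (0 : ℝ) a, ∃ g : ℝ → EuclideanSpace ℂ (Fin n),
      AnalyticAt ℝ g x₀ ∧ ∀ᶠ x in nhdsWithin x₀ (Icc (0 : ℝ) a), y x = g x := by
  intro x₀ hx₀
  set s : Set ℝ := Icc (-x₀) (a - x₀) with hs
  set Y : ℝ → EuclideanSpace ℂ (Fin n) := fun t => y (x₀ + t) with hYdef
  have hmaps : MapsTo (fun t => x₀ + t) s (Icc 0 a) := fun t ht =>
    ⟨by linarith [ht.1], by linarith [ht.2]⟩
  have h0 : (0 : ℝ) ∈ s := ⟨by linarith [hx₀.1], by linarith [hx₀.2]⟩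
  have hY : ContDiffOn ℝ (⊤ : ℕ∞) Y s :=
    hy.comp (contDiff_const.add contDiff_id).contDiffOn hmaps
  have hne : (𝓝[s \ {0}] (0 : ℝ)).NeBot := by
    rw [← mem_closure_iff_nhdsWithin_neBot]
    have hnt : s.Nontrivial :=
      ⟨-x₀, left_mem_Icc.2 (by linarith), a - x₀, right_mem_Icc.2 (by linarith),
        by intro h; linarith⟩
    have := (isPreconnected_Icc (a := -x₀) (b := a - x₀)).preperfect_of_nontrivial hnt 0 h0
    exact accPt_principal_iff_clusterPt.1 this |> mem_closure_iff_clusterPt.2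
  have hderiv : ∀ t ∈ s, HasDerivWithinAt Y (derivWithin y (Icc 0 a) (x₀ + t)) s t :=
    fun t ht => by
      have h1 := ((hy.differentiableOn (by simp)) _ (hmaps ht)).hasDerivWithinAt
      have h2 : HasDerivWithinAt (fun t => x₀ + t) 1 s t :=
        ((hasDerivAt_id t).const_add x₀).hasDerivWithinAt
      have h3 := HasDerivWithinAt.scomp t h1 h2 hmaps
      rw [one_smul] at h3
      exact h3
  have hFa : AnalyticAt ℝ (fun p : ℝ × EuclideanSpace ℂ (Fin n) => F (x₀ + p.1, p.2)) (0, Y 0) :=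
    AnalyticAt.comp (g := F)
      (f := fun p : ℝ × EuclideanSpace ℂ (Fin n) => (x₀ + p.1, p.2))
      (by simpa [hYdef] using hF _ (hgraph x₀ hx₀))
      ((analyticAt_const.add analyticAt_fst).prod analyticAt_snd)
  have hYc : ContinuousWithinAt Y s 0 := hY.continuousOn 0 h0
  obtain ⟨g, hg, hgY⟩ : ∃ g : ℝ → EuclideanSpace ℂ (Fin n),
      AnalyticAt ℝ g 0 ∧ ∀ᶠ t in 𝓝[s] 0, Y t = g t := by
    rcases eq_or_ne x₀ 0 with rfl | hx0
    · have hsol : IsBriotBouquetSolution s (fun p => F (0 + p.1, p.2)) Y := by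
        refine ⟨hYc, ?_⟩
        filter_upwards [self_mem_nhdsWithin] with t ht _
        refine ⟨_, hderiv t ht, ?_⟩
        simpa only [hYdef, zero_add] using hode _ (hmaps ht)
      exact hsol.exists_analyticAt (convex_Icc _ _) h0 hFa hY
    · have hsol : IsBriotBouquetSolution s
          (fun p => (p.1 / (x₀ + p.1)) • F (x₀ + p.1, p.2)) Y := by
        refine ⟨hYc, ?_⟩
        have hev : ∀ᶠ t in 𝓝[s] 0, x₀ + t ≠ 0 := by
          refine nhdsWithin_le_nhds (ContinuousAt.eventually_ne (by fun_prop) (by simpa))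
        filter_upwards [self_mem_nhdsWithin, hev] with t ht ht0 _
        refine ⟨_, hderiv t ht, ?_⟩
        simp only [hYdef]
        rw [← hode _ (hmaps ht), smul_smul, div_mul_cancel₀ _ ht0]
      refine hsol.exists_analyticAt (convex_Icc _ _) h0 ?_ hY
      exact (analyticAt_fst.div (analyticAt_const.add analyticAt_fst) (by simpa)).smul hFa
  refine ⟨fun x => g (x - x₀), ?_, ?_⟩
  · exact AnalyticAt.comp (g := g) (f := fun x => x - x₀) (by simpa using hg)
      (analyticAt_id.sub analyticAt_const)
  · have hlim : Tendsto (fun x => x - x₀) (𝓝[Icc 0 a] x₀) (𝓝[s] 0) := by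
      refine tendsto_nhdsWithin_iff.2 ⟨?_, ?_⟩
      · refine tendsto_nhdsWithin_of_tendsto_nhds ?_
        have : ContinuousAt (fun x => x - x₀) x₀ := by fun_prop
        simpa [ContinuousAt] using this
      · filter_upwards [self_mem_nhdsWithin] with x hx
        exact ⟨by linarith [hx.1], by linarith [hx.2]⟩
    filter_upwards [hlim.eventually hgY] with x hx
    simpa [hYdef] using hx
end

section
/- Let F be real-analytic on an open neighborhood of (0,0) ∈ ℝ × ℝⁿ, and let y : [0,a] → ℝⁿ be a C∞ solution of x·y'(x) = F(x,y(x)) which is flat at x = 0, i.e., y(0) = 0 and all derivatives of y vanish at x = 0. Then y vanishes identically on a neighborhood of 0 in [0,a]. -/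
open Set

open Filter Topology

/-- A smooth function on `[0,a]` that is flat at `0` is `O(x ^ k)` for every `k`. -/
theorem exists_norm_le_pow_of_flat {E : Type*} [NormedAddCommGroup E] [NormedSpace ℝ E]
    {a : ℝ} (ha : 0 < a) {y : ℝ → E} (hy : ContDiffOn ℝ (⊤ : ℕ∞) y (Icc 0 a))
    (hflat : ∀ k : ℕ, iteratedDerivWithin k y (Icc 0 a) 0 = 0) (k : ℕ) :
    ∃ C, ∀ x ∈ Icc 0 a, ‖y x‖ ≤ C * x ^ (k + 1) := by
  obtain ⟨C, hC⟩ := exists_taylor_mean_remainder_bound (n := k) ha.le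
    (hy.of_le (by exact_mod_cast le_top))
  refine ⟨C, fun x hx ↦ ?_⟩
  simpa [taylor_within_apply, hflat] using hC x hx

/-- A function analytic at `0` that is `O(x ^ k)` from the right for every `k` vanishes near `0`. -/
theorem AnalyticAt.eventually_eq_zero_of_norm_le_pow {E : Type*} [NormedAddCommGroup E]
    [NormedSpace ℝ E] {g : ℝ → E} (hg : AnalyticAt ℝ g 0)
    (h : ∀ k : ℕ, ∃ C, ∀ᶠ x in 𝓝[>] (0 : ℝ), ‖g x‖ ≤ C * x ^ (k + 1)) :
    ∀ᶠ x in 𝓝 0, g x = 0 := by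
  by_contra hne
  obtain ⟨m, φ, hφ, hφ0, hgφ⟩ := hg.exists_eventuallyEq_pow_smul_nonzero_iff.2 hne
  obtain ⟨C, hC⟩ := h m
  have hle : ∀ᶠ x in 𝓝[>] (0 : ℝ), ‖φ x‖ ≤ C * x := by
    filter_upwards [hC, hgφ.filter_mono nhdsWithin_le_nhds, self_mem_nhdsWithin] with x hx hx' hx0
    have hx0 : 0 < x := hx0
    rw [hx', sub_zero, norm_smul, norm_pow, Real.norm_of_nonneg hx0.le] at hx
    refine le_of_mul_le_mul_left (hx.trans_eq ?_) (pow_pos hx0 m)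
    ring
  have hlim : Tendsto (fun x ↦ C * x) (𝓝[>] (0 : ℝ)) (𝓝 0) := by
    have : Tendsto (fun x ↦ C * x) (𝓝 (0 : ℝ)) (𝓝 (C * 0)) :=
      Continuous.tendsto (by fun_prop) 0
    rw [mul_zero] at this
    exact this.mono_left nhdsWithin_le_nhds
  have := le_of_tendsto_of_tendsto (hφ.continuousAt.norm.mono_left nhdsWithin_le_nhds) hlim hle
  exact hφ0 (norm_le_zero_iff.1 this)

/-- If `‖x • y' x‖ ≤ N * ‖y x‖` on `(0,δ)` and `y = O(x ^ (N + 1))`, then `y` vanishes there. -/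
theorem eq_zero_of_norm_smul_deriv_le {E : Type*} [NormedAddCommGroup E] [InnerProductSpace ℝ E]
    {δ : ℝ} {y y' : ℝ → E} (hy : ∀ x ∈ Ioo 0 δ, HasDerivAt y (y' x) x) {N : ℕ}
    (hN : ∀ x ∈ Ioo 0 δ, ‖x • y' x‖ ≤ N * ‖y x‖) {C : ℝ}
    (hC : ∀ x ∈ Ioo 0 δ, ‖y x‖ ≤ C * x ^ (N + 1)) :
    ∀ x ∈ Ioo 0 δ, y x = 0 := by
  have hu : ∀ x ∈ Ioo 0 δ, HasDerivAt (fun x ↦ ‖y x‖ ^ 2 / x ^ (2 * N))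
      ((2 * inner ℝ (y x) (y' x) * x ^ (2 * N) - ‖y x‖ ^ 2 * ((2 * N : ℕ) * x ^ (2 * N - 1)))
        / (x ^ (2 * N)) ^ 2) x := fun x hx ↦
    (hy x hx).norm_sq.fun_div (hasDerivAt_pow (2 * N) x) (pow_pos hx.1 _).ne'
  have hanti : AntitoneOn (fun x ↦ ‖y x‖ ^ 2 / x ^ (2 * N)) (Ioo 0 δ) := by
    refine antitoneOn_of_deriv_nonpos (convex_Ioo 0 δ)
      (fun x hx ↦ (hu x hx).continuousAt.continuousWithinAt)
      (fun x hx ↦ (hu x (interior_subset hx)).differentiableAt.differentiableWithinAt)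
      fun x hx ↦ ?_
    have hx := interior_subset hx
    rw [(hu x hx).deriv]
    refine div_nonpos_of_nonpos_of_nonneg ?_ (by positivity)
    have hinner : x * inner ℝ (y x) (y' x) ≤ N * ‖y x‖ ^ 2 := by
      rw [← real_inner_smul_right]
      calc inner ℝ (y x) (x • y' x) ≤ ‖y x‖ * ‖x • y' x‖ := real_inner_le_norm _ _
        _ ≤ ‖y x‖ * (N * ‖y x‖) := by gcongr; exact hN x hx
        _ = N * ‖y x‖ ^ 2 := by ring
    refine nonpos_of_mul_nonpos_right (a := x) ?_ hx.1
    have hpow : x * ((2 * N : ℕ) * x ^ (2 * N - 1)) = 2 * N * x ^ (2 * N) := by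
      rcases Nat.eq_zero_or_pos N with rfl | hpos
      · simp
      · obtain ⟨m, hm⟩ : ∃ m, 2 * N = m + 1 := ⟨2 * N - 1, by lia⟩
        have : (2 * N : ℝ) = ((m + 1 : ℕ) : ℝ) := by rw [← hm]; push_cast; ring
        rw [this, hm, Nat.add_sub_cancel, pow_succ]
        ring
    calc x * (2 * inner ℝ (y x) (y' x) * x ^ (2 * N)
          - ‖y x‖ ^ 2 * ((2 * N : ℕ) * x ^ (2 * N - 1)))
        = 2 * x ^ (2 * N) * (x * inner ℝ (y x) (y' x))
          - ‖y x‖ ^ 2 * (x * ((2 * N : ℕ) * x ^ (2 * N - 1))) := by ring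
      _ = 2 * x ^ (2 * N) * (x * inner ℝ (y x) (y' x) - N * ‖y x‖ ^ 2) := by rw [hpow]; ring
      _ ≤ 0 := mul_nonpos_of_nonneg_of_nonpos (by have := hx.1; positivity) (by linarith)
  intro x hx
  have hle : ∀ᶠ s in 𝓝[>] (0 : ℝ), ‖y x‖ ^ 2 / x ^ (2 * N) ≤ C ^ 2 * s ^ 2 := by
    filter_upwards [Ioo_mem_nhdsGT hx.1] with s hs
    have hs' : s ∈ Ioo 0 δ := ⟨hs.1, hs.2.trans hx.2⟩
    refine (hanti hs' hx hs.2.le).trans ?_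
    rw [div_le_iff₀ (pow_pos hs.1 _)]
    calc ‖y s‖ ^ 2 ≤ (C * s ^ (N + 1)) ^ 2 := by gcongr; exact hC s hs'
      _ = C ^ 2 * s ^ 2 * s ^ (2 * N) := by ring
  have hlim : Tendsto (fun s ↦ C ^ 2 * s ^ 2) (𝓝[>] (0 : ℝ)) (𝓝 0) := by
    have : Tendsto (fun s ↦ C ^ 2 * s ^ 2) (𝓝 (0 : ℝ)) (𝓝 (C ^ 2 * 0 ^ 2)) :=
      Continuous.tendsto (by fun_prop) 0
    simp only [ne_eq, OfNat.ofNat_ne_zero, not_false_eq_true, zero_pow, mul_zero] at this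
    exact this.mono_left nhdsWithin_le_nhds
  have h0 := ge_of_tendsto hlim hle
  rw [div_le_iff₀ (pow_pos hx.1 _), zero_mul] at h0
  simpa using le_antisymm h0 (sq_nonneg _)

/-- **Flat smooth solutions of a Briot–Bouquet ODE vanish near the singular point.**
If `F` is real-analytic near `(0,0) ∈ ℝ × ℝⁿ` and `y : [0,a] → ℝⁿ` is a `C∞` solution of
`x·y'(x) = F(x,y(x))` which is flat at `x = 0` (i.e. `y` and all its derivatives vanish
at `0`), then `y ≡ 0` on a neighborhood of `0` in `[0,a]`. -/
theorem stmt9 {n : ℕ} (hn : 1 ≤ n) (a : ℝ) (ha : 0 < a)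
    (F : ℝ × EuclideanSpace ℝ (Fin n) → EuclideanSpace ℝ (Fin n))
    (U : Set (ℝ × EuclideanSpace ℝ (Fin n))) (hU : IsOpen U)
    (hU0 : ((0 : ℝ), (0 : EuclideanSpace ℝ (Fin n))) ∈ U)
    (hF : AnalyticOnNhd ℝ F U)
    (y : ℝ → EuclideanSpace ℝ (Fin n))
    (hy : ContDiffOn ℝ (⊤ : ℕ∞) y (Icc (0 : ℝ) a))
    (hflat : ∀ k : ℕ, iteratedDerivWithin k y (Icc (0 : ℝ) a) 0 = 0)
    (hode : ∀ x ∈ Icc (0 : ℝ) a, x • derivWithin y (Icc (0 : ℝ) a) x = F (x, y x)) :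
    ∃ δ > (0 : ℝ), ∀ x ∈ Icc (0 : ℝ) a, x < δ → y x = 0 := by
  have hy0 : y 0 = 0 := by simpa using hflat 0
  have hud : UniqueDiffOn ℝ (Icc (0 : ℝ) a) := uniqueDiffOn_Icc ha
  have hdy : ContDiffOn ℝ (⊤ : ℕ∞) (derivWithin y (Icc 0 a)) (Icc 0 a) :=
    hy.derivWithin hud (by simp)
  have hdflat (k : ℕ) : iteratedDerivWithin k (derivWithin y (Icc 0 a)) (Icc 0 a) 0 = 0 := by
    rw [← iteratedDerivWithin_succ']
    exact hflat (k + 1)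
  have hF0 := hF _ hU0
  obtain ⟨K, t, ht, hK⟩ := (hF0.contDiffAt (n := 1)).exists_lipschitzOnWith
  have hty : ∀ᶠ x in 𝓝[≥] (0 : ℝ), (x, y x) ∈ t := by
    have hc : ContinuousWithinAt y (Icc 0 a) 0 := hy.continuousOn 0 ⟨le_rfl, ha.le⟩
    have hc : Tendsto y (𝓝[≥] 0) (𝓝 0) := by
      rwa [ContinuousWithinAt, hy0, nhdsWithin_Icc_eq_nhdsGE ha] at hc
    exact ((tendsto_id.mono_left nhdsWithin_le_nhds).prodMk_nhds hc) ht
  have ht0 : ∀ᶠ x in 𝓝 (0 : ℝ), (x, (0 : EuclideanSpace ℝ (Fin n))) ∈ t :=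
    (Continuous.prodMk_left (0 : EuclideanSpace ℝ (Fin n))).continuousAt ht
  have hlip : ∀ x, (x, y x) ∈ t → (x, (0 : EuclideanSpace ℝ (Fin n))) ∈ t →
      ‖F (x, y x) - F (x, 0)‖ ≤ K * ‖y x‖ := fun x h₁ h₂ ↦ by
    simpa using hK.norm_sub_le h₁ h₂
  have hFz : ∀ᶠ x in 𝓝 (0 : ℝ), F (x, 0) = 0 := by
    refine AnalyticAt.eventually_eq_zero_of_norm_le_pow
      (hF0.comp_of_eq (analyticAt_id.prod analyticAt_const) rfl) fun k ↦ ?_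
    obtain ⟨C, hC⟩ := exists_norm_le_pow_of_flat ha hy hflat k
    obtain ⟨D, hD⟩ := exists_norm_le_pow_of_flat ha hdy hdflat k
    refine ⟨a * D + K * C, ?_⟩
    filter_upwards [hty.filter_mono (nhdsWithin_mono _ Ioi_subset_Ici_self),
      ht0.filter_mono nhdsWithin_le_nhds, Ioo_mem_nhdsGT ha] with x h₁ h₂ hx
    have hx' := Ioo_subset_Icc_self hx
    have hode' : ‖F (x, y x)‖ ≤ a * (D * x ^ (k + 1)) := by
      rw [← hode x hx', norm_smul, Real.norm_of_nonneg hx'.1]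
      exact mul_le_mul hx'.2 (hD x hx') (norm_nonneg _) ha.le
    calc ‖F (x, 0)‖ ≤ ‖F (x, y x)‖ + ‖F (x, y x) - F (x, 0)‖ := norm_le_insert _ _
      _ ≤ a * (D * x ^ (k + 1)) + K * (C * x ^ (k + 1)) := by
        refine add_le_add hode' ((hlip x h₁ h₂).trans ?_)
        gcongr
        exact hC x hx'
      _ = (a * D + K * C) * x ^ (k + 1) := by ring
  obtain ⟨N, hN⟩ := exists_nat_ge (K : ℝ)
  have hev : ∀ᶠ x in 𝓝[>] (0 : ℝ), x < a ∧ ‖F (x, y x)‖ ≤ N * ‖y x‖ := by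
    filter_upwards [hty.filter_mono (nhdsWithin_mono _ Ioi_subset_Ici_self),
      ht0.filter_mono nhdsWithin_le_nhds, Ioo_mem_nhdsGT ha,
      hFz.filter_mono nhdsWithin_le_nhds] with x h₁ h₂ hx hz
    have := hlip x h₁ h₂
    rw [hz, sub_zero] at this
    exact ⟨hx.2, this.trans (by gcongr)⟩
  obtain ⟨δ, hδ, hδ'⟩ := mem_nhdsGT_iff_exists_Ioo_subset.1 hev
  obtain ⟨C, hC⟩ := exists_norm_le_pow_of_flat ha hy hflat N
  have hIcc : ∀ x ∈ Ioo 0 δ, x ∈ Icc 0 a := fun x hx ↦ ⟨hx.1.le, (hδ' hx).1.le⟩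
  have hzero := eq_zero_of_norm_smul_deriv_le (y := y) (y' := derivWithin y (Icc 0 a)) (δ := δ)
    (fun x hx ↦ ((hy.differentiableOn (by simp)) x (hIcc x hx)).hasDerivWithinAt.hasDerivAt
      (Icc_mem_nhds hx.1 (hδ' hx).1))
    (N := N) (fun x hx ↦ by rw [hode x (hIcc x hx)]; exact (hδ' hx).2)
    (fun x hx ↦ hC x (hIcc x hx))
  refine ⟨δ, hδ, fun x hx hxδ ↦ ?_⟩
  rcases hx.1.eq_or_lt with rfl | hpos
  · exact hy0
  · exact hzero x ⟨hpos, hxδ⟩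
end

section
/- Let C > 0 and a > 0, and let y : (0,a] → ℝⁿ be a C¹ map with y(x) ≠ 0 for all x ∈ (0,a] and satisfying the differential inequality |y'(x)| ≤ (C/x)·|y(x)| for all x ∈ (0,a], where |·| is the Euclidean norm. Then |y(x)| ≥ |y(a)|·(x/a)^C for all x ∈ (0,a]. In particular, such a y cannot be flat at x = 0. -/
open Set

/-- If `‖y'‖ ≤ (C / x) * ‖y‖` on `(0, a]`, then `log (‖y x‖ ^ 2) - 2 * C * log x` is
nonincreasing there. -/
theorem antitoneOn_log_norm_sq_sub {E : Type*} [NormedAddCommGroup E] [InnerProductSpace ℝ E]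
    {C a : ℝ} {y y' : ℝ → E}
    (hderiv : ∀ x ∈ Ioc (0 : ℝ) a, HasDerivWithinAt y (y' x) (Ioc (0 : ℝ) a) x)
    (hne : ∀ x ∈ Ioc (0 : ℝ) a, y x ≠ 0)
    (hineq : ∀ x ∈ Ioc (0 : ℝ) a, ‖y' x‖ ≤ (C / x) * ‖y x‖) :
    AntitoneOn (fun x ↦ Real.log (‖y x‖ ^ 2) - 2 * C * Real.log x) (Ioc 0 a) := by
  have hd : ∀ x ∈ Ioc (0 : ℝ) a,
      HasDerivWithinAt (fun x ↦ Real.log (‖y x‖ ^ 2) - 2 * C * Real.log x)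
        (2 * inner ℝ (y x) (y' x) / ‖y x‖ ^ 2 - 2 * C * x⁻¹) (Ioc 0 a) x := fun x hx ↦
    ((hderiv x hx).norm_sq.log (pow_ne_zero 2 (norm_ne_zero_iff.2 (hne x hx)))).sub
      ((Real.hasDerivAt_log hx.1.ne').hasDerivWithinAt.const_mul (2 * C))
  refine antitoneOn_of_hasDerivWithinAt_nonpos (convex_Ioc 0 a)
    (fun x hx ↦ (hd x hx).continuousWithinAt)
    (fun x hx ↦ (hd x (interior_subset hx)).mono interior_subset) fun x hx ↦ ?_
  replace hx := interior_subset hx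
  have hy : 0 < ‖y x‖ := norm_pos_iff.2 (hne x hx)
  rw [sub_nonpos, div_le_iff₀ (by positivity)]
  calc 2 * inner ℝ (y x) (y' x) ≤ 2 * (‖y x‖ * ‖y' x‖) := by
        gcongr
        exact real_inner_le_norm _ _
    _ ≤ 2 * (‖y x‖ * (C / x * ‖y x‖)) := by
        gcongr
        exact hineq x hx
    _ = 2 * C * x⁻¹ * ‖y x‖ ^ 2 := by ring

/-- **Gronwall-type lower bound for Briot–Bouquet ODEs.**
If `y : (0,a] → ℝⁿ` is `C¹`, never zero, and satisfies `‖y'(x)‖ ≤ (C/x)·‖y(x)‖`,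
then `‖y(x)‖ ≥ ‖y(a)‖·(x/a)^C` on `(0,a]`; in particular `y` cannot be flat at `0`. -/
theorem stmt10 {n : ℕ} (hn : 1 ≤ n) (C a : ℝ) (hC : 0 < C) (ha : 0 < a)
    (y y' : ℝ → EuclideanSpace ℝ (Fin n))
    (hderiv : ∀ x ∈ Ioc (0 : ℝ) a, HasDerivWithinAt y (y' x) (Ioc (0 : ℝ) a) x)
    (hcont : ContinuousOn y' (Ioc (0 : ℝ) a))
    (hne : ∀ x ∈ Ioc (0 : ℝ) a, y x ≠ 0)
    (hineq : ∀ x ∈ Ioc (0 : ℝ) a, ‖y' x‖ ≤ (C / x) * ‖y x‖) :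
    ∀ x ∈ Ioc (0 : ℝ) a, ‖y a‖ * (x / a) ^ C ≤ ‖y x‖ := by
  intro x hx
  have haa : a ∈ Ioc (0 : ℝ) a := ⟨ha, le_rfl⟩
  have hya : 0 < ‖y a‖ := norm_pos_iff.2 (hne a haa)
  have hyx : 0 < ‖y x‖ := norm_pos_iff.2 (hne x hx)
  have hxa : 0 < x / a := div_pos hx.1 ha
  have h := antitoneOn_log_norm_sq_sub hderiv hne hineq hx haa hx.2
  simp only [Real.log_pow, Nat.cast_ofNat] at h
  rw [← Real.log_le_log_iff (by positivity) hyx, Real.log_mul hya.ne' (by positivity),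
    Real.log_rpow hxa, Real.log_div hx.1.ne' ha.ne']
  linarith
end
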